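/- arXiv:1904.07196 — 9 statements merged into one kernel-verified Lean document; each statement's English description precedes it below -/
import Mathlib

section
/- Let I be a nonempty open real interval, let f: I → ℝ be strictly monotone, and let g: conv(f(I)) → I be the generalized left inverse of f. Then for every y ∈ conv(f(I)), liminf_{x → g(y)} f(x) ≤ y ≤ limsup_{x → g(y)} f(x). Consequently, if f is lower semicontinuous at g(y) then f(g(y)) ≤ y, and if f is upper semicontinuous at g(y) then y ≤ f(g(y)). -/
open Filter Topology Set

/-- A function that is monotone or antitone on an open set is bounded near each of its points. -/
theorem exists_eventually_mem_Icc_of_monotoneOn_or_antitoneOn {I : Set ℝ} {f : ℝ → ℝ} {p : ℝ}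
    (hI : I ∈ 𝓝 p) (hf : MonotoneOn f I ∨ AntitoneOn f I) :
    ∃ m M : ℝ, ∀ᶠ x in 𝓝 p, f x ∈ Icc m M := by
  obtain ⟨ε, hε, hball⟩ := Metric.mem_nhds_iff.1 hI
  have ha : p - ε / 2 ∈ I := hball (by rw [Real.ball_eq_Ioo]; constructor <;> linarith)
  have hb : p + ε / 2 ∈ I := hball (by rw [Real.ball_eq_Ioo]; constructor <;> linarith)
  have hnear : ∀ᶠ x in 𝓝 p, x ∈ Ioo (p - ε / 2) (p + ε / 2) :=
    Ioo_mem_nhds (by linarith) (by linarith)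
  rcases hf with hf | hf
  · refine ⟨f (p - ε / 2), f (p + ε / 2), ?_⟩
    filter_upwards [hnear, hI] with x hx hxI
    exact ⟨hf ha hxI hx.1.le, hf hxI hb hx.2.le⟩
  · refine ⟨f (p + ε / 2), f (p - ε / 2), ?_⟩
    filter_upwards [hnear, hI] with x hx hxI
    exact ⟨hf hxI hb hx.2.le, hf ha hxI hx.1.le⟩

/-- If `g` is monotone on a set containing `f '' I` and is a left inverse of `f` on `I`, then
`f` takes values below `y` immediately to the left of `g y` and above `y` immediately to its
right. -/
theorem eventually_lt_and_eventually_gt_of_monotoneOn_leftInvOn {I S : Set ℝ} {f g : ℝ → ℝ}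
    {y : ℝ} (hI : I ∈ 𝓝 (g y)) (hS : f '' I ⊆ S) (hy : y ∈ S) (hg : MonotoneOn g S)
    (hgf : LeftInvOn g f I) :
    (∀ᶠ x in 𝓝[<] (g y), f x < y) ∧ ∀ᶠ x in 𝓝[>] (g y), y < f x := by
  constructor <;>
    filter_upwards [self_mem_nhdsWithin, mem_nhdsWithin_of_mem_nhds hI] with x hx hxI <;>
    by_contra! hle
  · exact absurd (hg hy (hS (mem_image_of_mem f hxI)) hle) (by rw [hgf hxI]; exact not_le.2 hx)
  · exact absurd (hg (hS (mem_image_of_mem f hxI)) hy hle) (by rw [hgf hxI]; exact not_le.2 hx)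

/-- If `g` is antitone on a set containing `f '' I` and is a left inverse of `f` on `I`, then
`f` takes values above `y` immediately to the left of `g y` and below `y` immediately to its
right. -/
theorem eventually_gt_and_eventually_lt_of_antitoneOn_leftInvOn {I S : Set ℝ} {f g : ℝ → ℝ}
    {y : ℝ} (hI : I ∈ 𝓝 (g y)) (hS : f '' I ⊆ S) (hy : y ∈ S) (hg : AntitoneOn g S)
    (hgf : LeftInvOn g f I) :
    (∀ᶠ x in 𝓝[<] (g y), y < f x) ∧ ∀ᶠ x in 𝓝[>] (g y), f x < y := by
  constructor <;>
    filter_upwards [self_mem_nhdsWithin, mem_nhdsWithin_of_mem_nhds hI] with x hx hxI <;>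
    by_contra! hle
  · exact absurd (hg (hS (mem_image_of_mem f hxI)) hy hle) (by rw [hgf hxI]; exact not_le.2 hx)
  · exact absurd (hg hy (hS (mem_image_of_mem f hxI)) hle) (by rw [hgf hxI]; exact not_le.2 hx)

/-- A monotone or antitone left inverse `g` of `f` forces `f` to take values on both sides of `y`
arbitrarily close to `g y`. -/
theorem frequently_le_and_frequently_ge_of_leftInvOn {I S : Set ℝ} {f g : ℝ → ℝ} {y : ℝ}
    (hI : I ∈ 𝓝 (g y)) (hS : f '' I ⊆ S) (hy : y ∈ S) (hg : MonotoneOn g S ∨ AntitoneOn g S)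
    (hgf : LeftInvOn g f I) :
    (∃ᶠ x in 𝓝[≠] (g y), f x ≤ y) ∧ ∃ᶠ x in 𝓝[≠] (g y), y ≤ f x := by
  have hlt : 𝓝[<] (g y) ≤ 𝓝[≠] (g y) := nhdsWithin_mono _ fun _ hx => ne_of_lt hx
  have hgt : 𝓝[>] (g y) ≤ 𝓝[≠] (g y) := nhdsWithin_mono _ fun _ hx => ne_of_gt hx
  rcases hg with hg | hg
  · obtain ⟨h₁, h₂⟩ := eventually_lt_and_eventually_gt_of_monotoneOn_leftInvOn hI hS hy hg hgf
    exact ⟨(h₁.mono fun _ h => h.le).frequently.filter_mono hlt,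
      (h₂.mono fun _ h => h.le).frequently.filter_mono hgt⟩
  · obtain ⟨h₁, h₂⟩ := eventually_gt_and_eventually_lt_of_antitoneOn_leftInvOn hI hS hy hg hgf
    exact ⟨(h₂.mono fun _ h => h.le).frequently.filter_mono hgt,
      (h₁.mono fun _ h => h.le).frequently.filter_mono hlt⟩


/-- Lemma SMF (liminf/limsup part): if `g` is the generalized left inverse of a
strictly monotone function `f` on a nonempty open interval `I`, then for every
`y ∈ conv(f(I))` one has `liminf_{x → g y} f x ≤ y ≤ limsup_{x → g y} f x`;
consequently lower (resp. upper) semicontinuity of `f` at `g y` gives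
`f (g y) ≤ y` (resp. `y ≤ f (g y)`). -/
theorem stmt_2 (I : Set ℝ) (hIopen : IsOpen I) (hIne : I.Nonempty)
    (hIconn : I.OrdConnected) (f : ℝ → ℝ)
    (hf : StrictMonoOn f I ∨ StrictAntiOn f I) (g : ℝ → ℝ)
    (hgmaps : Set.MapsTo g (convexHull ℝ (f '' I)) I)
    (hgmono : MonotoneOn g (convexHull ℝ (f '' I)) ∨
      AntitoneOn g (convexHull ℝ (f '' I)))
    (hgleft : ∀ x ∈ I, g (f x) = x) :
    ∀ y ∈ convexHull ℝ (f '' I),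
      (Filter.liminf f (nhdsWithin (g y) {g y}ᶜ) ≤ y ∧
        y ≤ Filter.limsup f (nhdsWithin (g y) {g y}ᶜ)) ∧
      (LowerSemicontinuousWithinAt f I (g y) → f (g y) ≤ y) ∧
      (UpperSemicontinuousWithinAt f I (g y) → y ≤ f (g y)) := by
  intro y hy
  have hI : I ∈ 𝓝 (g y) := hIopen.mem_nhds (hgmaps hy)
  have hle_nhds : 𝓝[≠] (g y) ≤ 𝓝[I] (g y) := by
    rw [hIopen.nhdsWithin_eq (hgmaps hy)]
    exact nhdsWithin_le_nhds
  obtain ⟨hle, hge⟩ := frequently_le_and_frequently_ge_of_leftInvOn hI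
    (subset_convexHull ℝ (f '' I)) hy hgmono hgleft
  obtain ⟨m, M, hmM⟩ := exists_eventually_mem_Icc_of_monotoneOn_or_antitoneOn hI
    (hf.imp StrictMonoOn.monotoneOn StrictAntiOn.antitoneOn)
  have hmM' : ∀ᶠ x in 𝓝[≠] (g y), f x ∈ Icc m M := hmM.filter_mono nhdsWithin_le_nhds
  refine ⟨⟨liminf_le_of_frequently_le hle ?_, le_limsup_of_frequently_le hge ?_⟩, ?_, ?_⟩
  · exact isBoundedUnder_of_eventually_ge (hmM'.mono fun _ h => h.1)
  · exact isBoundedUnder_of_eventually_le (hmM'.mono fun _ h => h.2)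
  · intro hlsc
    by_contra! hlt
    exact hle (((hlsc y hlt).filter_mono hle_nhds).mono fun _ h => not_le.2 h)
  · intro husc
    by_contra! hlt
    exact hge (((husc y hlt).filter_mono hle_nhds).mono fun _ h => not_le.2 h)
end

section
/- Let I be a nonempty open real interval, let f: I → ℝ be strictly increasing, and let p = (p_1,…,p_n): I → ℝ_+^n. Then for all x = (x_1,…,x_n) ∈ I^n and y ∈ I, the equality y = A_{f,p}(x) holds if and only if Σ_{i=1}^n p_i(x_i)(f(z) − f(x_i)) < 0 for every z ∈ I with z < y and Σ_{i=1}^n p_i(x_i)(f(z) − f(x_i)) > 0 for every z ∈ I with z > y. -/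
/-- Theorem BM2 (increasing case): `y = A_{f,p}(x)` holds iff the function
`z ↦ ∑ pᵢ(xᵢ)(f z − f xᵢ)` is negative for `z ∈ I` with `z < y` and positive
for `z ∈ I` with `z > y`. -/
theorem stmt_4 (I : Set ℝ) (hIopen : IsOpen I) (hIne : I.Nonempty)
    (hIconn : I.OrdConnected) (n : ℕ) (hn : 2 ≤ n) (f : ℝ → ℝ)
    (hf : StrictMonoOn f I) (finv : ℝ → ℝ)
    (hmaps : Set.MapsTo finv (convexHull ℝ (f '' I)) I)
    (hmono : MonotoneOn finv (convexHull ℝ (f '' I)) ∨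
      AntitoneOn finv (convexHull ℝ (f '' I)))
    (hleft : ∀ x ∈ I, finv (f x) = x)
    (p : Fin n → ℝ → ℝ) (hp : ∀ i, ∀ x ∈ I, 0 < p i x) :
    ∀ x : Fin n → ℝ, (∀ i, x i ∈ I) → ∀ y ∈ I,
      (y = finv ((∑ i, p i (x i) * f (x i)) / (∑ i, p i (x i))) ↔
        ((∀ z ∈ I, z < y → (∑ i, p i (x i) * (f z - f (x i))) < 0) ∧
          (∀ z ∈ I, y < z → 0 < (∑ i, p i (x i) * (f z - f (x i)))))) := by
  have hmon : MonotoneOn finv (convexHull ℝ (f '' I)) := by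
    refine hmono.resolve_right fun hanti => ?_
    obtain ⟨a, ha⟩ := hIne
    obtain ⟨b, hab, hsub⟩ := (mem_nhdsGE_iff_exists_Icc_subset).1
      (mem_nhdsWithin_of_mem_nhds (hIopen.mem_nhds ha))
    have hb : b ∈ I := hsub (Set.right_mem_Icc.2 (le_of_lt hab))
    have h := hanti (subset_convexHull ℝ _ (Set.mem_image_of_mem f ha))
      (subset_convexHull ℝ _ (Set.mem_image_of_mem f hb)) (hf ha hb hab).le
    rw [hleft a ha, hleft b hb] at h
    exact absurd hab (not_lt.2 h)
  intro x hx y hy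
  have hP : 0 < ∑ i, p i (x i) :=
    Finset.sum_pos (fun i _ => hp i _ (hx i)) ⟨⟨0, by omega⟩, Finset.mem_univ _⟩
  set m := (∑ i, p i (x i) * f (x i)) / (∑ i, p i (x i)) with hm
  have hmem : m ∈ convexHull ℝ (f '' I) := by
    have h := Finset.centerMass_mem_convexHull (R := ℝ) Finset.univ
      (w := fun i => p i (x i)) (z := fun i => f (x i)) (s := f '' I)
      (fun i _ => (hp i _ (hx i)).le) hP (fun i _ => Set.mem_image_of_mem f (hx i))
    simpa [Finset.centerMass, hm, div_eq_inv_mul] using h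
  have hsum : ∀ z, ∑ i, p i (x i) * (f z - f (x i)) = (∑ i, p i (x i)) * (f z - m) := by
    intro z
    simp only [mul_sub, Finset.sum_sub_distrib, ← Finset.sum_mul]
    rw [hm, mul_div_cancel₀ _ hP.ne']
  have hneg : ∀ b : ℝ, (∑ i, p i (x i)) * b < 0 ↔ b < 0 := fun b =>
    ⟨fun h => neg_of_mul_neg_right h hP.le, mul_neg_of_pos_of_neg hP⟩
  simp only [hsum, mul_pos_iff_of_pos_left hP, hneg, sub_neg, sub_pos]
  have hle : ∀ z ∈ I, f z ≤ m → z ≤ finv m := fun z hz h => by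
    simpa only [hleft z hz] using
      hmon (subset_convexHull ℝ _ (Set.mem_image_of_mem f hz)) hmem h
  have hge : ∀ z ∈ I, m ≤ f z → finv m ≤ z := fun z hz h => by
    simpa only [hleft z hz] using
      hmon hmem (subset_convexHull ℝ _ (Set.mem_image_of_mem f hz)) h
  constructor
  · rintro rfl
    exact ⟨fun z hz hzy => not_le.1 fun h => (hge z hz h).not_gt hzy,
      fun z hz hzy => not_le.1 fun h => (hle z hz h).not_gt hzy⟩
  · rintro ⟨hlt, hgt⟩
    have hw := hmaps hmem
    rcases lt_trichotomy y (finv m) with h | h | h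
    · obtain ⟨z, hyz, hzw⟩ := exists_between h
      have hz := hIconn.out hy hw ⟨hyz.le, hzw.le⟩
      exact absurd hzw (hge z hz (hgt z hz hyz).le).not_gt
    · exact h
    · obtain ⟨z, hwz, hzy⟩ := exists_between h
      have hz := hIconn.out hw hy ⟨hwz.le, hzy.le⟩
      exact absurd hwz (hle z hz (hlt z hz hzy).le).not_gt
end

section
/- Let I be a nonempty open real interval, let f, g: I → ℝ be strictly monotone, and let p = (p_1,…,p_n): I → ℝ_+^n and q = (q_1,…,q_n): I → ℝ_+^n. If there exist a, b, c, d ∈ ℝ with ad ≠ bc such that cf + d > 0 on I, g = (af + b)/(cf + d) on I, and q_i = (cf + d)·p_i on I for every i ∈ {1,…,n}, then the n-variable generalized Bajraktarević means A_{f,p} and A_{g,q} are identical on I^n. -/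
open Set

/-- A monotone or antitone left inverse of `f` with values in an order-connected set `I` is unique
on any set containing `f '' I`. -/
theorem eqOn_of_leftInverse_of_monotoneOn_or_antitoneOn {f h k : ℝ → ℝ} {I C : Set ℝ}
    (hI : I.OrdConnected) (hfC : MapsTo f I C)
    (hmaps : MapsTo h C I) (hmono : MonotoneOn h C ∨ AntitoneOn h C) (hleft : ∀ x ∈ I, h (f x) = x)
    (kmaps : MapsTo k C I) (kmono : MonotoneOn k C ∨ AntitoneOn k C)
    (kleft : ∀ x ∈ I, k (f x) = x) : EqOn h k C := by
  have not_lt : ∀ {h k : ℝ → ℝ}, MapsTo h C I → (MonotoneOn h C ∨ AntitoneOn h C) →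
      (∀ x ∈ I, h (f x) = x) → MapsTo k C I → (MonotoneOn k C ∨ AntitoneOn k C) →
      (∀ x ∈ I, k (f x) = x) → ∀ y ∈ C, ¬ h y < k y := by
    intro h k hmaps hmono hleft kmaps kmono kleft y hy hlt
    obtain ⟨w, hw, hw'⟩ := exists_between hlt
    obtain ⟨z, hz, hz'⟩ := exists_between hw'
    have hwI : w ∈ I := hI.out (hmaps hy) (kmaps hy) ⟨hw.le, hw'.le⟩
    have hzI : z ∈ I := hI.out (hmaps hy) (kmaps hy) ⟨(hw.trans hz).le, hz'.le⟩
    have hfw := hfC hwI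
    have hfz := hfC hzI
    have hw₁ := hleft w hwI
    have hw₂ := kleft w hwI
    have hz₁ := hleft z hzI
    have hz₂ := kleft z hzI
    rcases hmono with hm | hm <;> rcases kmono with km | km
    · have h₁ := hm.reflect_lt hy hfw (by linarith)
      have h₂ := km.reflect_lt hfw hy (by linarith)
      exact lt_asymm h₁ h₂
    · have h₁ := hm.reflect_lt hfw hfz (by linarith)
      have h₂ := km.reflect_lt hfw hfz (by linarith)
      exact lt_asymm h₁ h₂
    · have h₁ := hm.reflect_lt hfw hfz (by linarith)
      have h₂ := km.reflect_lt hfw hfz (by linarith)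
      exact lt_asymm h₁ h₂
    · have h₁ := hm.reflect_lt hy hfw (by linarith)
      have h₂ := km.reflect_lt hfw hy (by linarith)
      exact lt_asymm h₁ h₂
  intro y hy
  exact le_antisymm (le_of_not_gt (not_lt kmaps kmono kleft hmaps hmono hleft y hy))
    (le_of_not_gt (not_lt hmaps hmono hleft kmaps kmono kleft y hy))

/-- A Möbius transformation is monotone or antitone where its denominator is positive. -/
theorem monotoneOn_or_antitoneOn_moebius (a b c d : ℝ) :
    MonotoneOn (fun t : ℝ => (a * t + b) / (c * t + d)) {t | 0 < c * t + d} ∨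
      AntitoneOn (fun t : ℝ => (a * t + b) / (c * t + d)) {t | 0 < c * t + d} := by
  rcases le_total (b * c) (a * d) with h | h
  · left
    intro s hs t ht hst
    simp only [mem_ofPred_eq] at hs ht
    rw [div_le_div_iff₀ hs ht]
    nlinarith [mul_nonneg (sub_nonneg.2 h) (sub_nonneg.2 hst)]
  · right
    intro s hs t ht hst
    simp only [mem_ofPred_eq] at hs ht
    rw [div_le_div_iff₀ ht hs]
    nlinarith [mul_nonneg (sub_nonneg.2 h) (sub_nonneg.2 hst)]

/-- The part of an order-connected set `H` that a monotone or antitone map sends to an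
order-connected set is order-connected. -/
theorem ordConnected_inter_preimage {T : ℝ → ℝ} {H D : Set ℝ} (hH : H.OrdConnected)
    (hD : D.OrdConnected) (hT : MonotoneOn T H ∨ AntitoneOn T H) :
    (H ∩ T ⁻¹' D).OrdConnected := by
  refine ⟨fun s hs t ht r hr => ?_⟩
  have hrH := hH.out hs.1 ht.1 hr
  refine ⟨hrH, ?_⟩
  rcases hT with hT | hT
  · exact hD.out hs.2 ht.2 ⟨hT hs.1 hrH hr.1, hT hrH ht.1 hr.2⟩
  · exact hD.out ht.2 hs.2 ⟨hT hrH ht.1 hr.2, hT hs.1 hrH hr.1⟩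

/-- Theorem BM3 (the canonical case of equality): if `cf + d > 0`,
`g = (af+b)/(cf+d)` and `qᵢ = (cf+d)pᵢ` on `I` with `ad ≠ bc`, then the
generalized Bajraktarević means `A_{f,p}` and `A_{g,q}` coincide on `Iⁿ`. -/
theorem stmt_6 (I : Set ℝ) (hIopen : IsOpen I) (hIne : I.Nonempty)
    (hIconn : I.OrdConnected) (n : ℕ) (hn : 2 ≤ n) (f g : ℝ → ℝ)
    (hf : StrictMonoOn f I ∨ StrictAntiOn f I)
    (hg : StrictMonoOn g I ∨ StrictAntiOn g I)
    (finvf : ℝ → ℝ)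
    (hfmaps : Set.MapsTo finvf (convexHull ℝ (f '' I)) I)
    (hfmono : MonotoneOn finvf (convexHull ℝ (f '' I)) ∨
      AntitoneOn finvf (convexHull ℝ (f '' I)))
    (hfleft : ∀ x ∈ I, finvf (f x) = x)
    (finvg : ℝ → ℝ)
    (hgmaps : Set.MapsTo finvg (convexHull ℝ (g '' I)) I)
    (hgmono : MonotoneOn finvg (convexHull ℝ (g '' I)) ∨
      AntitoneOn finvg (convexHull ℝ (g '' I)))
    (hgleft : ∀ x ∈ I, finvg (g x) = x)
    (p q : Fin n → ℝ → ℝ)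
    (hp : ∀ i, ∀ x ∈ I, 0 < p i x) (hq : ∀ i, ∀ x ∈ I, 0 < q i x)
    (a b c d : ℝ) (habcd : a * d ≠ b * c)
    (hpos : ∀ x ∈ I, 0 < c * f x + d)
    (hgf : ∀ x ∈ I, g x = (a * f x + b) / (c * f x + d))
    (hqp : ∀ i, ∀ x ∈ I, q i x = (c * f x + d) * p i x) :
    ∀ x : Fin n → ℝ, (∀ i, x i ∈ I) →
      finvf ((∑ i, p i (x i) * f (x i)) / (∑ i, p i (x i))) =
      finvg ((∑ i, q i (x i) * g (x i)) / (∑ i, q i (x i))) := by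
  intro x hx
  set T : ℝ → ℝ := fun t => (a * t + b) / (c * t + d) with hTdef
  set H : Set ℝ := {t | 0 < c * t + d} with hHdef
  have hT : MonotoneOn T H ∨ AntitoneOn T H := monotoneOn_or_antitoneOn_moebius a b c d
  have hH : H.OrdConnected := by
    refine ⟨fun s hs t ht r hr => ?_⟩
    simp only [hHdef, mem_ofPred_eq] at hs ht ⊢
    rcases le_total 0 c with hc | hc
    · nlinarith [mul_le_mul_of_nonneg_left hr.1 hc]
    · nlinarith [mul_le_mul_of_nonpos_left hr.2 hc]
  have hsub : convexHull ℝ (f '' I) ⊆ H ∩ T ⁻¹' convexHull ℝ (g '' I) := by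
    refine convexHull_min ?_
      (ordConnected_inter_preimage hH (convex_convexHull ℝ _).ordConnected hT).convex
    rintro _ ⟨z, hz, rfl⟩
    refine ⟨hpos z hz, ?_⟩
    have : T (f z) = g z := (hgf z hz).symm
    rw [mem_preimage, this]
    exact subset_convexHull ℝ _ (mem_image_of_mem g hz)
  have hsubH : convexHull ℝ (f '' I) ⊆ H := fun _ hy => (hsub hy).1
  have hTmaps : MapsTo T (convexHull ℝ (f '' I)) (convexHull ℝ (g '' I)) := fun _ hy => (hsub hy).2
  have hcomp : MonotoneOn (finvg ∘ T) (convexHull ℝ (f '' I)) ∨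
      AntitoneOn (finvg ∘ T) (convexHull ℝ (f '' I)) := by
    rcases hgmono with hm | hm <;> rcases hT with hT | hT
    · exact .inl (hm.comp (hT.mono hsubH) hTmaps)
    · exact .inr (fun s hs t ht hst => hm (hTmaps ht) (hTmaps hs) (hT (hsubH hs) (hsubH ht) hst))
    · exact .inr (fun s hs t ht hst => hm (hTmaps hs) (hTmaps ht) (hT (hsubH hs) (hsubH ht) hst))
    · exact .inl (hm.comp (hT.mono hsubH) hTmaps)
  have heq : EqOn finvf (finvg ∘ T) (convexHull ℝ (f '' I)) :=
    eqOn_of_leftInverse_of_monotoneOn_or_antitoneOn hIconn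
      (fun z hz => subset_convexHull ℝ _ (mem_image_of_mem f hz)) hfmaps hfmono hfleft
      (hgmaps.comp hTmaps) hcomp
      (fun z hz => by
        have : T (f z) = g z := (hgf z hz).symm
        rw [Function.comp_apply, this, hgleft z hz])
  have : NeZero n := ⟨by omega⟩
  have hP : 0 < ∑ i, p i (x i) :=
    Finset.sum_pos (fun i _ => hp i _ (hx i)) Finset.univ_nonempty
  have hmem : (∑ i, p i (x i) * f (x i)) / (∑ i, p i (x i)) ∈ convexHull ℝ (f '' I) := by
    have := Finset.centerMass_mem_convexHull (R := ℝ) (s := f '' I) Finset.univ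
      (w := fun i => p i (x i)) (z := fun i => f (x i)) (fun i _ => (hp i _ (hx i)).le) hP
      (fun i _ => mem_image_of_mem f (hx i))
    simpa [Finset.centerMass, div_eq_inv_mul] using this
  have hnum : ∑ i, q i (x i) * g (x i) =
      a * (∑ i, p i (x i) * f (x i)) + b * ∑ i, p i (x i) := by
    rw [Finset.mul_sum, Finset.mul_sum, ← Finset.sum_add_distrib]
    refine Finset.sum_congr rfl fun i _ => ?_
    have := (hpos _ (hx i)).ne'
    rw [hqp i _ (hx i), hgf _ (hx i)]
    field_simp
  have hden : ∑ i, q i (x i) = c * (∑ i, p i (x i) * f (x i)) + d * ∑ i, p i (x i) := by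
    rw [Finset.mul_sum, Finset.mul_sum, ← Finset.sum_add_distrib]
    refine Finset.sum_congr rfl fun i _ => ?_
    rw [hqp i _ (hx i)]
    ring
  rw [heq hmem, Function.comp_apply, hnum, hden, hTdef]
  congr 1
  dsimp only
  rw [← mul_div_mul_right _ _ hP.ne']
  congr 1 <;> field_simp
end

section
/- Let I be a nonempty open real interval, let f, g: I → ℝ be continuous strictly monotone functions, let n ≥ 2, and let p = (p_1,…,p_n): I → ℝ_+^n and q = (q_1,…,q_n): I → ℝ_+^n. Assume there exists an open set U ⊆ I^n containing the diagonal diag(I^n) such that A_{f,p} = A_{g,q} on U. Then for every i ∈ {1,…,n}, the function p_i is continuous on I if and only if q_i is continuous on I. -/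
open Set Filter Topology

/-- A left inverse of a continuous function on an interval is also a right inverse on the convex
hull of the image. -/
lemma apply_leftInverse_of_mem_convexHull {I : Set ℝ} (hI : I.OrdConnected) {f finv : ℝ → ℝ}
    (hf : ContinuousOn f I) (hleft : ∀ x ∈ I, finv (f x) = x) {a : ℝ}
    (ha : a ∈ convexHull ℝ (f '' I)) : finv a ∈ I ∧ f (finv a) = a := by
  have hconv : Convex ℝ (f '' I) :=
    (hI.isPreconnected.image f hf).ordConnected.convex
  rw [hconv.convexHull_eq] at ha
  obtain ⟨z, hz, rfl⟩ := ha
  rw [hleft z hz]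
  exact ⟨hz, rfl⟩

/-- If `f` is strictly monotone on an open set containing the values of `m`, then convergence of
`f ∘ m` to `f b` forces convergence of `m` to `b`. -/
lemma StrictMonoOn.tendsto_of_tendsto_comp {I : Set ℝ} (hI : IsOpen I) {f : ℝ → ℝ}
    (hf : StrictMonoOn f I) {α : Type*} {l : Filter α} {m : α → ℝ} {b : ℝ} (hb : b ∈ I)
    (hm : ∀ᶠ x in l, m x ∈ I) (h : Tendsto (fun x => f (m x)) l (𝓝 (f b))) :
    Tendsto m l (𝓝 b) := by
  obtain ⟨ε, hε, hball⟩ := Metric.isOpen_iff.1 hI b hb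
  rw [Real.ball_eq_Ioo] at hball
  refine tendsto_order.2 ⟨fun a hab => ?_, fun a hab => ?_⟩
  · obtain ⟨c, hc, hcb⟩ := exists_between (max_lt hab (sub_lt_self b hε))
    have hcI : c ∈ I := hball ⟨(le_max_right _ _).trans_lt hc, by linarith⟩
    filter_upwards [hm, h.eventually (lt_mem_nhds (hf hcI hb hcb))] with x hx hfx
    exact ((le_max_left _ _).trans_lt hc).trans ((hf.lt_iff_lt hcI hx).1 hfx)
  · obtain ⟨c, hbc, hc⟩ := exists_between (lt_min hab (lt_add_of_pos_right b hε))
    have hcI : c ∈ I := hball ⟨by linarith, hc.trans_le (min_le_right _ _)⟩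
    filter_upwards [hm, h.eventually (gt_mem_nhds (hf hb hcI hbc))] with x hx hfx
    exact ((hf.lt_iff_lt hx hcI).1 hfx).trans (hc.trans_le (min_le_left _ _))

/-- Version of `StrictMonoOn.tendsto_of_tendsto_comp` for strictly monotone or antitone maps. -/
lemma tendsto_of_tendsto_comp_of_strictMonoOn_or_strictAntiOn {I : Set ℝ} (hI : IsOpen I)
    {f : ℝ → ℝ} (hf : StrictMonoOn f I ∨ StrictAntiOn f I) {α : Type*} {l : Filter α}
    {m : α → ℝ} {b : ℝ} (hb : b ∈ I) (hm : ∀ᶠ x in l, m x ∈ I)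
    (h : Tendsto (fun x => f (m x)) l (𝓝 (f b))) : Tendsto m l (𝓝 b) := by
  rcases hf with hf | hf
  · exact hf.tendsto_of_tendsto_comp hI hb hm h
  · exact hf.neg.tendsto_of_tendsto_comp hI hb hm h.neg

lemma sum_update_const {ι : Type*} [Fintype ι] [DecidableEq ι] (F : ι → ℝ → ℝ) (i : ι)
    (u x : ℝ) :
    ∑ j, F j (Function.update (Function.const ι u) i x j) =
      F i x + ∑ j ∈ Finset.univ.erase i, F j u := by
  rw [← Finset.add_sum_erase _ _ (Finset.mem_univ i), Function.update_self]
  congr 1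
  refine Finset.sum_congr rfl fun j hj => ?_
  rw [Function.update_of_ne (Finset.ne_of_mem_erase hj), Function.const_apply]

/-- The defining equation of a Bajraktarević mean at a point with all coordinates but the `i`-th
equal. -/
lemma bajraktarevic_update_const {I : Set ℝ} (hI : I.OrdConnected) {ι : Type*} [Fintype ι]
    [DecidableEq ι] {f finv : ℝ → ℝ} (hf : ContinuousOn f I)
    (hleft : ∀ x ∈ I, finv (f x) = x) {p : ι → ℝ → ℝ} (hp : ∀ i, ∀ x ∈ I, 0 < p i x)
    (i : ι) {u x m : ℝ} (hu : u ∈ I) (hx : x ∈ I)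
    (hm : m = finv ((∑ j, p j (Function.update (Function.const ι u) i x j) *
        f (Function.update (Function.const ι u) i x j)) /
      (∑ j, p j (Function.update (Function.const ι u) i x j)))) :
    m ∈ I ∧ f m = (p i x * f x + (∑ j ∈ Finset.univ.erase i, p j u) * f u) /
      (p i x + ∑ j ∈ Finset.univ.erase i, p j u) := by
  have hy : ∀ j, Function.update (Function.const ι u) i x j ∈ I := fun j => by
    rcases eq_or_ne j i with rfl | hj
    · rwa [Function.update_self]
    · rwa [Function.update_of_ne hj]
  have hmem : (∑ j, p j (Function.update (Function.const ι u) i x j) *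
        f (Function.update (Function.const ι u) i x j)) /
      (∑ j, p j (Function.update (Function.const ι u) i x j)) ∈ convexHull ℝ (f '' I) := by
    have h := Finset.univ.centerMass_mem_convexHull (R := ℝ) (s := f '' I)
      (w := fun j => p j (Function.update (Function.const ι u) i x j))
      (z := fun j => f (Function.update (Function.const ι u) i x j))
      (fun j _ => (hp j _ (hy j)).le)
      (Finset.sum_pos (fun j _ => hp j _ (hy j)) ⟨i, Finset.mem_univ i⟩)
      (fun j _ => mem_image_of_mem f (hy j))
    simpa [Finset.centerMass, div_eq_inv_mul] using h
  rw [hm]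
  obtain ⟨h1, h2⟩ := apply_leftInverse_of_mem_convexHull hI hf hleft hmem
  refine ⟨h1, h2.trans ?_⟩
  rw [sum_update_const p, sum_update_const (fun j t => p j t * f t), Finset.sum_mul]

/-- If two Bajraktarević means with continuous generators agree near the diagonal, then continuity
of a weight function of the first implies continuity of the corresponding one of the second. -/
lemma continuousOn_weight_of_bajraktarevic_eq {I : Set ℝ} (hIopen : IsOpen I)
    (hIconn : I.OrdConnected) {ι : Type*} [Fintype ι] [DecidableEq ι] [Nontrivial ι]
    {f g finvf finvg : ℝ → ℝ} (hfc : ContinuousOn f I) (hgc : ContinuousOn g I)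
    (hf : StrictMonoOn f I ∨ StrictAntiOn f I) (hg : InjOn g I)
    (hfleft : ∀ x ∈ I, finvf (f x) = x) (hgleft : ∀ x ∈ I, finvg (g x) = x)
    {p q : ι → ℝ → ℝ} (hp : ∀ i, ∀ x ∈ I, 0 < p i x) (hq : ∀ i, ∀ x ∈ I, 0 < q i x)
    {U : Set (ι → ℝ)} (hUopen : IsOpen U) (hUdiag : ∀ x ∈ I, Function.const ι x ∈ U)
    (heq : ∀ y ∈ U,
      finvf ((∑ i, p i (y i) * f (y i)) / (∑ i, p i (y i))) =
      finvg ((∑ i, q i (y i) * g (y i)) / (∑ i, q i (y i))))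
    (i : ι) (hpi : ContinuousOn (p i) I) : ContinuousOn (q i) I := by
  have hinj : InjOn f I := hf.elim StrictMonoOn.injOn StrictAntiOn.injOn
  intro x₀ hx₀
  refine ContinuousAt.continuousWithinAt ?_
  have hInhds := hIopen.mem_nhds hx₀
  have hV : {z : ℝ × ℝ | Function.update (Function.const ι z.1) i z.2 ∈ U} ∈
      𝓝 x₀ ×ˢ 𝓝 x₀ := by
    rw [← nhds_prod_eq]
    have hc : Continuous fun z : ℝ × ℝ => Function.update (Function.const ι z.1) i z.2 :=
      (continuous_pi fun _ => continuous_fst).update i continuous_snd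
    refine hc.continuousAt.preimage_mem_nhds (hUopen.mem_nhds ?_)
    have h := Function.update_eq_self i (Function.const ι x₀)
    rw [Function.const_apply] at h
    exact h.symm ▸ hUdiag x₀ hx₀
  obtain ⟨u, ⟨huU, huI⟩, hux⟩ : ∃ u, ((∀ᶠ x in 𝓝 x₀,
      Function.update (Function.const ι u) i x ∈ U) ∧ u ∈ I) ∧ u ≠ x₀ := by
    have h := (Eventually.curry hV).and hInhds
    exact ((h.filter_mono nhdsWithin_le_nhds).and
      (self_mem_nhdsWithin (s := {x₀}ᶜ))).exists
  set P := ∑ j ∈ Finset.univ.erase i, p j u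
  set Q := ∑ j ∈ Finset.univ.erase i, q j u
  have hne : (Finset.univ.erase i).Nonempty := by
    obtain ⟨j, hj⟩ := exists_ne i
    exact ⟨j, Finset.mem_erase.2 ⟨hj, Finset.mem_univ j⟩⟩
  have hP : 0 < P := Finset.sum_pos (fun j _ => hp j u huI) hne
  set m : ℝ → ℝ := fun x => finvf ((∑ j, p j (Function.update (Function.const ι u) i x j) *
        f (Function.update (Function.const ι u) i x j)) /
      (∑ j, p j (Function.update (Function.const ι u) i x j)))
  have hmf : ∀ x ∈ I, m x ∈ I ∧ f (m x) = (p i x * f x + P * f u) / (p i x + P) :=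
    fun x hx => bajraktarevic_update_const hIconn hfc hfleft hp i huI hx rfl
  have hfx := hfc.continuousAt hInhds
  have hgx := hgc.continuousAt hInhds
  have hpx := hpi.continuousAt hInhds
  have hmI := (hmf x₀ hx₀).1
  have hmcont : ContinuousAt m x₀ := by
    refine tendsto_of_tendsto_comp_of_strictMonoOn_or_strictAntiOn hIopen hf hmI
      (by filter_upwards [hInhds] with x hx using (hmf x hx).1) ?_
    have hc : ContinuousAt (fun x => (p i x * f x + P * f u) / (p i x + P)) x₀ :=
      ((hpx.mul hfx).add continuousAt_const).div (hpx.add continuousAt_const)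
        (add_pos (hp i x₀ hx₀) hP).ne'
    rw [(hmf x₀ hx₀).2]
    refine hc.tendsto.congr' ?_
    filter_upwards [hInhds] with x hx using (hmf x hx).2.symm
  have hgm : ContinuousAt (fun x => g (m x)) x₀ :=
    ContinuousAt.comp (f := m) (hgc.continuousAt (hIopen.mem_nhds hmI)) hmcont
  have hmne : ∀ x ∈ I, u ≠ x → g x - g (m x) ≠ 0 := by
    intro x hx hne h0
    have hmx : m x = x := hg (hmf x hx).1 hx (by linarith)
    have h := (hmf x hx).2
    rw [hmx, eq_div_iff (add_pos (hp i x hx) hP).ne'] at h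
    refine hne (hinj huI hx (mul_left_cancel₀ hP.ne' ?_))
    linarith
  have hc : ContinuousAt (fun x => Q * (g (m x) - g u) / (g x - g (m x))) x₀ :=
    (continuousAt_const.mul (hgm.sub continuousAt_const)).div (hgx.sub hgm)
      (hmne x₀ hx₀ hux)
  refine hc.congr ?_
  filter_upwards [hInhds, huU, eventually_ne_nhds hux.symm] with x hx hxU hxu
  have h := (bajraktarevic_update_const hIconn hgc hgleft hq i huI hx (heq _ hxU)).2
  have hQ : 0 < Q := Finset.sum_pos (fun j _ => hq j u huI) hne
  change g (m x) = (q i x * g x + Q * g u) / (q i x + Q) at h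
  rw [eq_div_iff (add_pos (hq i x hx) hQ).ne'] at h
  rw [div_eq_iff (hmne x hx hxu.symm)]
  linarith

/-- Lemma reg (i): if `A_{f,p} = A_{g,q}` on an open set `U ⊆ Iⁿ` containing
the diagonal, then `pᵢ` is continuous on `I` iff `qᵢ` is continuous on `I`. -/
theorem stmt_7 (I : Set ℝ) (hIopen : IsOpen I) (hIne : I.Nonempty)
    (hIconn : I.OrdConnected) (n : ℕ) (hn : 2 ≤ n) (f g : ℝ → ℝ)
    (hfc : ContinuousOn f I) (hgc : ContinuousOn g I)
    (hf : StrictMonoOn f I ∨ StrictAntiOn f I)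
    (hg : StrictMonoOn g I ∨ StrictAntiOn g I)
    (finvf : ℝ → ℝ)
    (hfmaps : Set.MapsTo finvf (convexHull ℝ (f '' I)) I)
    (hfmono : MonotoneOn finvf (convexHull ℝ (f '' I)) ∨
      AntitoneOn finvf (convexHull ℝ (f '' I)))
    (hfleft : ∀ x ∈ I, finvf (f x) = x)
    (finvg : ℝ → ℝ)
    (hgmaps : Set.MapsTo finvg (convexHull ℝ (g '' I)) I)
    (hgmono : MonotoneOn finvg (convexHull ℝ (g '' I)) ∨
      AntitoneOn finvg (convexHull ℝ (g '' I)))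
    (hgleft : ∀ x ∈ I, finvg (g x) = x)
    (p q : Fin n → ℝ → ℝ)
    (hp : ∀ i, ∀ x ∈ I, 0 < p i x) (hq : ∀ i, ∀ x ∈ I, 0 < q i x)
    (U : Set (Fin n → ℝ)) (hUopen : IsOpen U)
    (hUsub : U ⊆ {y : Fin n → ℝ | ∀ i, y i ∈ I})
    (hUdiag : ∀ x ∈ I, Function.const (Fin n) x ∈ U)
    (heq : ∀ y ∈ U,
      finvf ((∑ i, p i (y i) * f (y i)) / (∑ i, p i (y i))) =
      finvg ((∑ i, q i (y i) * g (y i)) / (∑ i, q i (y i)))) :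
    ∀ i, ContinuousOn (p i) I ↔ ContinuousOn (q i) I := by
  have : Nontrivial (Fin n) := Fin.nontrivial_iff_two_le.2 hn
  have hfinj : Set.InjOn f I := hf.elim StrictMonoOn.injOn StrictAntiOn.injOn
  have hginj : Set.InjOn g I := hg.elim StrictMonoOn.injOn StrictAntiOn.injOn
  exact fun i =>
    ⟨continuousOn_weight_of_bajraktarevic_eq hIopen hIconn hfc hgc hf hginj hfleft hgleft hp hq
      hUopen hUdiag heq i,
    continuousOn_weight_of_bajraktarevic_eq hIopen hIconn hgc hfc hg hfinj hgleft hfleft hq hp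
      hUopen hUdiag (fun y hy => (heq y hy).symm) i⟩
end

section
/- Let I be a nonempty open real interval, let f: I → ℝ be differentiable on I with nonvanishing first derivative, let p = (p_1,…,p_n): I → ℝ_+^n, let i ∈ {1,…,n}, and assume that p_i is continuous on I. Then the first-order partial derivative ∂_i A_{f,p} exists at every point of the diagonal diag(I^n), and for all x ∈ I, ∂_i A_{f,p}(x,…,x) = p_i(x)/p_0(x), where p_0 = p_1 + … + p_n. -/
/-- The `n`-variable generalized Bajraktarević mean built from `f`, its
generalized left inverse `finv`, and the weight functions `p`. -/
noncomputable def bmean {n : ℕ} (f finv : ℝ → ℝ) (p : Fin n → ℝ → ℝ)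
    (x : Fin n → ℝ) : ℝ :=
  finv ((∑ i, p i (x i) * f (x i)) / ∑ i, p i (x i))

open Filter Topology

/-- A product of a continuous function with a differentiable function vanishing at `x` is
differentiable at `x`. -/
lemma hasDerivAt_mul_sub_of_continuousAt {w f : ℝ → ℝ} {x f' : ℝ} (hw : ContinuousAt w x)
    (hf : HasDerivAt f f' x) :
    HasDerivAt (fun t => w t * (f t - f x)) (w x * f') x := by
  rw [hasDerivAt_iff_tendsto_slope] at hf ⊢
  refine ((hw.tendsto.mono_left nhdsWithin_le_nhds).mul hf).congr fun t => ?_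
  simp only [slope_def_field, sub_self, mul_zero, sub_zero]
  ring

/-- The image of a neighbourhood interval under a continuous strictly monotone function is a
neighbourhood of the image point. -/
lemma image_mem_nhds_of_strictMonoOn_or_strictAntiOn {I : Set ℝ} (hI : I.OrdConnected)
    {f : ℝ → ℝ} (hfc : ContinuousOn f I) (hf : StrictMonoOn f I ∨ StrictAntiOn f I)
    {x : ℝ} (hx : I ∈ 𝓝 x) : f '' I ∈ 𝓝 (f x) := by
  obtain ⟨ε, hε, hball⟩ := Metric.nhds_basis_closedBall.mem_iff.1 hx
  rw [Real.closedBall_eq_Icc] at hball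
  have hxI : x ∈ I := mem_of_mem_nhds hx
  have ha : x - ε ∈ I := hball ⟨le_rfl, by linarith⟩
  have hb : x + ε ∈ I := hball ⟨by linarith, le_rfl⟩
  have hsub : Set.uIcc (x - ε) (x + ε) ⊆ I := hI.uIcc_subset ha hb
  have himage : Set.uIcc (f (x - ε)) (f (x + ε)) ⊆ f '' I :=
    (intermediate_value_uIcc (hfc.mono hsub)).trans (Set.image_mono hsub)
  refine mem_of_superset ?_ himage
  rcases hf with hf | hf
  · have h₁ := hf ha hxI (by linarith)
    have h₂ := hf hxI hb (by linarith)
    rw [Set.uIcc_of_le (h₁.trans h₂).le]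
    exact Icc_mem_nhds h₁ h₂
  · have h₁ := hf ha hxI (by linarith)
    have h₂ := hf hxI hb (by linarith)
    rw [Set.uIcc_of_ge (h₂.trans h₁).le]
    exact Icc_mem_nhds h₂ h₁

/-- An antitone function mapping a neighbourhood onto a neighbourhood of the image point is
continuous at that point. -/
lemma continuousAt_of_antitoneOn_of_image_mem_nhds {g : ℝ → ℝ} {s : Set ℝ} {a : ℝ}
    (hg : AntitoneOn g s) (hs : s ∈ 𝓝 a) (him : g '' s ∈ 𝓝 (g a)) : ContinuousAt g a := by
  have h : ContinuousAt (fun y => OrderDual.toDual (g y)) a :=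
    continuousAt_of_monotoneOn_of_image_mem_nhds (f := fun y => OrderDual.toDual (g y))
      hg.dual_right hs him
  exact h

/-- Replacing one entry of a constant vector in the weighted average. -/
lemma bmean_update_const {n : ℕ} (f finv : ℝ → ℝ) (p : Fin n → ℝ → ℝ) (i : Fin n) (x t : ℝ)
    (h : p i t + ∑ l ∈ Finset.univ.erase i, p l x ≠ 0) :
    bmean f finv p (Function.update (Function.const (Fin n) x) i t) =
      finv (f x + p i t / (p i t + ∑ l ∈ Finset.univ.erase i, p l x) * (f t - f x)) := by
  have hsum (g : Fin n → ℝ → ℝ) :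
      ∑ l, g l (Function.update (Function.const (Fin n) x) i t l) =
        g i t + ∑ l ∈ Finset.univ.erase i, g l x := by
    rw [← Finset.add_sum_erase _ _ (Finset.mem_univ i), Function.update_self]
    congr 1
    refine Finset.sum_congr rfl fun l hl => ?_
    rw [Function.update_of_ne (Finset.ne_of_mem_erase hl), Function.const_apply]
  rw [bmean, hsum p, hsum fun l y => p l y * f y, ← Finset.sum_mul]
  congr 1
  field_simp
  ring

/-- Theorem DB (1): if `f` is differentiable with nonvanishing derivative and
`pᵢ` is continuous, then `∂ᵢ A_{f,p}` exists at the diagonal points and equals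
`pᵢ/p₀` there. -/
theorem stmt_10 (I : Set ℝ) (hIopen : IsOpen I) (hIne : I.Nonempty)
    (hIconn : I.OrdConnected) (n : ℕ) (hn : 2 ≤ n) (f : ℝ → ℝ)
    (hfd : DifferentiableOn ℝ f I) (hf' : ∀ x ∈ I, deriv f x ≠ 0)
    (hf : StrictMonoOn f I ∨ StrictAntiOn f I) (finv : ℝ → ℝ)
    (hmaps : Set.MapsTo finv (convexHull ℝ (f '' I)) I)
    (hmono : MonotoneOn finv (convexHull ℝ (f '' I)) ∨
      AntitoneOn finv (convexHull ℝ (f '' I)))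
    (hleft : ∀ x ∈ I, finv (f x) = x)
    (p : Fin n → ℝ → ℝ) (hp : ∀ i, ∀ x ∈ I, 0 < p i x)
    (i : Fin n) (hpi : ContinuousOn (p i) I) :
    ∀ x ∈ I,
      HasDerivAt
        (fun t => bmean f finv p (Function.update (Function.const (Fin n) x) i t))
        (p i x / ∑ l, p l x) x := by
  intro x hx
  have hI : I ∈ 𝓝 x := hIopen.mem_nhds hx
  have hfx : HasDerivAt f (deriv f x) x := (hfd.differentiableAt hI).hasDerivAt
  have himage : f '' I ∈ 𝓝 (f x) :=
    image_mem_nhds_of_strictMonoOn_or_strictAntiOn hIconn hfd.continuousOn hf hI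
  have hinv : finv '' (f '' I) ∈ 𝓝 (finv (f x)) := by
    have hid : finv '' (f '' I) = I := by
      rw [Set.image_image, Set.image_congr hleft, Set.image_id']
    rwa [hid, hleft x hx]
  have hcont : ContinuousAt finv (f x) := by
    have hsub := subset_convexHull ℝ (f '' I)
    rcases hmono with h | h
    · exact continuousAt_of_monotoneOn_of_image_mem_nhds (h.mono hsub) himage hinv
    · exact continuousAt_of_antitoneOn_of_image_mem_nhds (h.mono hsub) himage hinv
  have hfinv : HasDerivAt finv (deriv f x)⁻¹ (f x) := by
    refine HasDerivAt.of_local_left_inverse (f := f) hcont ?_ (hf' x hx) ?_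
    · rwa [hleft x hx]
    · filter_upwards [himage]
      rintro _ ⟨y, hy, rfl⟩
      rw [hleft y hy]
  set c := ∑ l ∈ Finset.univ.erase i, p l x with hc
  have hc₀ : 0 ≤ c := Finset.sum_nonneg fun l _ => (hp l x hx).le
  have hpos : ∀ t ∈ I, p i t + c ≠ 0 := fun t ht => (add_pos_of_pos_of_nonneg (hp i t ht) hc₀).ne'
  have hpc : ContinuousAt (p i) x := hpi.continuousAt hI
  have havg := (hasDerivAt_mul_sub_of_continuousAt
    (hpc.div (hpc.add continuousAt_const) (hpos x hx)) hfx).const_add (f x)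
  have hcomp := HasDerivAt.comp_of_eq x hfinv havg (by simp)
  have hderiv : (deriv f x)⁻¹ * (p i x / (p i x + c) * deriv f x) = p i x / ∑ l, p l x := by
    rw [← Finset.add_sum_erase _ _ (Finset.mem_univ i), ← hc]
    field_simp [hf' x hx]
  refine (hderiv ▸ hcomp).congr_of_eventuallyEq ?_
  filter_upwards [hI] with t ht
  exact bmean_update_const f finv p i x t (hpos t ht)
end

section
/- Let I be a nonempty open real interval, let f: I → ℝ be twice differentiable on I with nonvanishing first derivative, let p = (p_1,…,p_n): I → ℝ_+^n, and let i, j ∈ {1,…,n} with i ≠ j such that p_i and p_j are differentiable on I. Then the second-order mixed partial derivative ∂_i∂_j A_{f,p} exists at every point of diag(I^n), and for all x ∈ I, ∂_i∂_j A_{f,p}(x,…,x) = −(p_i p_j)'(x)/p_0(x)² − (p_i(x)p_j(x)/p_0(x)²)·(f''(x)/f'(x)), where p_0 = p_1 + … + p_n. -/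
open Set Filter Topology

/-- The weighted quotient whose image under the inverse of `f` is `bmean`. -/
noncomputable def bquot {n : ℕ} (f : ℝ → ℝ) (p : Fin n → ℝ → ℝ) (x : Fin n → ℝ) : ℝ :=
  (∑ l, p l (x l) * f (x l)) / ∑ l, p l (x l)

/-- The partial derivative of `bmean` in the `j`-th variable. -/
noncomputable def bmeanPartial {n : ℕ} (f finv : ℝ → ℝ) (p : Fin n → ℝ → ℝ) (j : Fin n)
    (x : Fin n → ℝ) : ℝ :=
  (deriv (p j) (x j) * (f (x j) - bquot f p x) + p j (x j) * deriv f (x j)) /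
    ((∑ l, p l (x l)) * deriv f (bmean f finv p x))

lemma hasDerivAt_sum_update {n : ℕ} {g : Fin n → ℝ → ℝ} {y : Fin n → ℝ} {k : Fin n} {g' : ℝ}
    (hg : HasDerivAt (g k) g' (y k)) :
    HasDerivAt (fun t => ∑ l, g l (Function.update y k t l)) g' (y k) := by
  have h : ∀ l ∈ Finset.univ, HasDerivAt (fun t => g l (Function.update y k t l))
      (if l = k then g' else 0) (y k) := by
    intro l _
    by_cases hl : l = k
    · subst hl
      simpa using hg
    · simpa [hl] using hasDerivAt_const (y k) (g l (y l))
  simpa using HasDerivAt.fun_sum h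

lemma hasDerivAt_leftInverse {f finv : ℝ → ℝ} {I : Set ℝ} {u : ℝ} (hI : I ∈ 𝓝 u)
    (hleft : ∀ x ∈ I, finv (f x) = x) (hfd : DifferentiableOn ℝ f I)
    (hc : ContinuousAt (deriv f) u) (hu : deriv f u ≠ 0) :
    HasDerivAt finv (deriv f u)⁻¹ (f u) := by
  have hs : HasStrictDerivAt f (deriv f u) u := by
    refine hasStrictDerivAt_of_hasDerivAt_of_continuousAt ?_ hc
    filter_upwards [eventually_mem_nhds_iff.2 hI] with x hx
    exact (hfd.differentiableAt hx).hasDerivAt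
  have hmap := hs.map_nhds_eq hu
  have hev : ∀ᶠ x in 𝓝 u, finv (f x) = x := by
    filter_upwards [hI] with x hx using hleft x hx
  have hfu : finv (f u) = u := hleft u (mem_of_mem_nhds hI)
  refine HasDerivAt.of_local_left_inverse (f := f) ?_ ?_ hu ?_
  · rw [ContinuousAt, hfu, ← hmap, tendsto_map'_iff]
    exact tendsto_id.congr' (hev.mono fun x hx => hx.symm)
  · rw [hfu]
    exact hs.hasDerivAt
  · rw [← hmap, eventually_map]
    exact hev.mono fun x hx => by rw [hx]

lemma bquot_mem_image {n : ℕ} (hn : 2 ≤ n) {I : Set ℝ} (hI : I.OrdConnected) {f : ℝ → ℝ}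
    (hf : ContinuousOn f I) {p : Fin n → ℝ → ℝ} (hp : ∀ l, ∀ x ∈ I, 0 < p l x)
    {y : Fin n → ℝ} (hy : ∀ l, y l ∈ I) : bquot f p y ∈ f '' I := by
  have hconv : Convex ℝ (f '' I) := (hI.isPreconnected.image f hf).ordConnected.convex
  have : Nonempty (Fin n) := ⟨⟨0, by omega⟩⟩
  have h := hconv.centerMass_mem (t := Finset.univ) (w := fun l => p l (y l))
    (z := fun l => f (y l)) (fun l _ => (hp l _ (hy l)).le)
    (Finset.sum_pos (fun l _ => hp l _ (hy l)) Finset.univ_nonempty)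
    (fun l _ => mem_image_of_mem f (hy l))
  simpa [Finset.centerMass, bquot, div_eq_inv_mul] using h

lemma hasDerivAt_bquot {n : ℕ} {f : ℝ → ℝ} {p : Fin n → ℝ → ℝ} {y : Fin n → ℝ} {k : Fin n}
    (hD : ∑ l, p l (y l) ≠ 0) (hf : DifferentiableAt ℝ f (y k))
    (hp : DifferentiableAt ℝ (p k) (y k)) :
    HasDerivAt (fun t => bquot f p (Function.update y k t))
      ((deriv (p k) (y k) * (f (y k) - bquot f p y) + p k (y k) * deriv f (y k)) /
        ∑ l, p l (y l)) (y k) := by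
  have hN := hasDerivAt_sum_update (g := fun l s => p l s * f s) (y := y)
    (hp.hasDerivAt.mul hf.hasDerivAt)
  have h := hN.fun_div (hasDerivAt_sum_update (g := p) hp.hasDerivAt) (by simpa using hD)
  simp only [Function.update_eq_self] at h
  refine h.congr_deriv ?_
  unfold bquot
  field_simp
  ring

lemma bquot_const {n : ℕ} {f : ℝ → ℝ} {p : Fin n → ℝ → ℝ} {x : ℝ} (hD : ∑ l, p l x ≠ 0) :
    bquot f p (Function.const (Fin n) x) = f x := by
  simp only [bquot, Function.const_apply, ← Finset.sum_mul]
  field_simp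

/-- Theorem DB (2a): if `f` is twice differentiable with nonvanishing first
derivative and `pᵢ, pⱼ` (`i ≠ j`) are differentiable, then the mixed partial
derivative `∂ᵢ∂ⱼ A_{f,p}` exists on the diagonal and equals
`−(pᵢpⱼ)'/p₀² − (pᵢpⱼ/p₀²)·(f''/f')` there. -/
theorem stmt_11 (I : Set ℝ) (hIopen : IsOpen I) (hIne : I.Nonempty)
    (hIconn : I.OrdConnected) (n : ℕ) (hn : 2 ≤ n) (f : ℝ → ℝ)
    (hfd : DifferentiableOn ℝ f I) (hfd2 : DifferentiableOn ℝ (deriv f) I)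
    (hf' : ∀ x ∈ I, deriv f x ≠ 0)
    (hf : StrictMonoOn f I ∨ StrictAntiOn f I) (finv : ℝ → ℝ)
    (hmaps : Set.MapsTo finv (convexHull ℝ (f '' I)) I)
    (hmono : MonotoneOn finv (convexHull ℝ (f '' I)) ∨
      AntitoneOn finv (convexHull ℝ (f '' I)))
    (hleft : ∀ x ∈ I, finv (f x) = x)
    (p : Fin n → ℝ → ℝ) (hp : ∀ l, ∀ x ∈ I, 0 < p l x)
    (i j : Fin n) (hij : i ≠ j)
    (hpi : DifferentiableOn ℝ (p i) I) (hpj : DifferentiableOn ℝ (p j) I) :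
    ∃ Pj : (Fin n → ℝ) → ℝ,
      (∀ y : Fin n → ℝ, (∀ l, y l ∈ I) →
        HasDerivAt (fun t => bmean f finv p (Function.update y j t))
          (Pj y) (y j)) ∧
      (∀ x ∈ I,
        HasDerivAt
          (fun t => Pj (Function.update (Function.const (Fin n) x) i t))
          (-(deriv (fun u => p i u * p j u) x / (∑ l, p l x) ^ 2)
            - p i x * p j x / (∑ l, p l x) ^ 2 *
              (deriv (deriv f) x / deriv f x)) x) := by
  have hnhds : ∀ x ∈ I, I ∈ 𝓝 x := fun x hx => hIopen.mem_nhds hx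
  have hD : ∀ y : Fin n → ℝ, (∀ l, y l ∈ I) → ∑ l, p l (y l) ≠ 0 := fun y hy =>
    (Finset.sum_pos (fun l _ => hp l _ (hy l)) ⟨i, Finset.mem_univ i⟩).ne'
  have hpartial : ∀ k, DifferentiableOn ℝ (p k) I → ∀ y : Fin n → ℝ, (∀ l, y l ∈ I) →
      HasDerivAt (fun t => bmean f finv p (Function.update y k t))
        (bmeanPartial f finv p k y) (y k) := by
    intro k hpk y hy
    obtain ⟨u, hu, hfu⟩ := bquot_mem_image hn hIconn hfd.continuousOn hp hy
    have hA : bmean f finv p y = u := by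
      change finv (bquot f p y) = u
      rw [← hfu, hleft u hu]
    have hinv := hasDerivAt_leftInverse (hnhds u hu) hleft hfd
      (hfd2.differentiableAt (hnhds u hu)).continuousAt (hf' u hu)
    have hq := hasDerivAt_bquot (hD y hy) (hfd.differentiableAt (hnhds _ (hy k)))
      (hpk.differentiableAt (hnhds _ (hy k)))
    have hcomp := HasDerivAt.comp_of_eq (y k) hinv hq (by simp [hfu])
    refine hcomp.congr_deriv ?_
    rw [bmeanPartial, hA, mul_comm (∑ l, p l (y l)), ← div_div, div_right_comm, inv_mul_eq_div]
  refine ⟨bmeanPartial f finv p j, hpartial j hpj, fun x hx => ?_⟩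
  have hc : ∀ l, Function.const (Fin n) x l ∈ I := fun _ => hx
  have hD0 : ∑ l, p l x ≠ 0 := hD _ hc
  have hf0 := hf' x hx
  have hpi' := hpi.differentiableAt (hnhds x hx)
  have hpj' := hpj.differentiableAt (hnhds x hx)
  have hAx : bmean f finv p (Function.const (Fin n) x) = x := by
    change finv (bquot f p _) = x
    rw [bquot_const hD0, hleft x hx]
  have hup : Function.update (Function.const (Fin n) x) i x = Function.const (Fin n) x :=
    Function.update_eq_self i _
  have hA := hpartial i hpi _ hc
  have hq := hasDerivAt_bquot (hD _ hc) (hfd.differentiableAt (hnhds x hx)) hpi'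
  have hS := hasDerivAt_sum_update (g := p) (y := Function.const (Fin n) x) hpi'.hasDerivAt
  have hdf := HasDerivAt.comp_of_eq (Function.const (Fin n) x i)
    (hfd2.differentiableAt (hnhds x hx)).hasDerivAt hA (by simp [hup, hAx])
  have hden := hS.fun_mul hdf
  have hnum := ((hq.const_sub (f x)).const_mul (deriv (p j) x)).add_const (p j x * deriv f x)
  have h := hnum.fun_div hden (by simpa [hup, hAx] using ⟨hD0, hf0⟩)
  simp only [bmeanPartial, Function.const_apply, hup, bquot_const hD0, hAx,
    Function.comp_apply, sub_self, mul_zero, zero_add] at h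
  simp only [bmeanPartial, Function.update_of_ne hij.symm, Function.const_apply]
  refine h.congr_deriv ?_
  rw [deriv_fun_mul hpi' hpj']
  field_simp
  ring
end

section
/- Let I be a nonempty open real interval, let f: I → ℝ be three times differentiable on I with nonvanishing first derivative, let p = (p_1,…,p_n): I → ℝ_+^n, and let i ∈ {1,…,n} such that p_i is twice continuously differentiable on I. Then the third-order partial derivative ∂_i³ A_{f,p} exists at every point of diag(I^n), and for all x ∈ I, ∂_i³ A_{f,p}(x,…,x) = 3(p_0 − p_i)(p_0 p_i'' − 2(p_i')²)(x)/p_0(x)³ + 3 p_i'(x)(p_0(x) − 2p_i(x))(p_0(x) − p_i(x))/p_0(x)³ · (f''(x)/f'(x)) − (p_i(x)(p_0(x) − p_i(x))/p_0(x)³)·(3p_i(x)(f''(x)/f'(x))² − (p_0(x) + p_i(x))·f'''(x)/f'(x)), where p_0 = p_1 + … + p_n. -/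
/-- If `g` is continuous at `x` and `c` is differentiable with a zero at `x`, then `g * c` is
differentiable at `x`. -/
lemma HasDerivAt.continuousAt_mul_of_eq_zero {g c : ℝ → ℝ} {c' x : ℝ} (hg : ContinuousAt g x)
    (hc : HasDerivAt c c' x) (h0 : c x = 0) : HasDerivAt (fun t => g t * c t) (g x * c') x := by
  rw [hasDerivAt_iff_tendsto_slope] at hc ⊢
  refine ((hg.tendsto.mono_left nhdsWithin_le_nhds).mul hc).congr fun t => ?_
  simp [slope, h0]
  ring

/-- The weighted mean of `f t` with weight `q t` and of fixed data with total weight `s` and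
weighted sum `r`. -/
noncomputable def weightedQuot (f q : ℝ → ℝ) (r s t : ℝ) : ℝ := (q t * f t + r) / (q t + s)

/-- The derivative of `weightedQuot f q r s`. -/
noncomputable def weightedQuotDeriv (f q : ℝ → ℝ) (r s t : ℝ) : ℝ :=
  (deriv q t * (f t - weightedQuot f q r s t) + q t * deriv f t) / (q t + s)

/-- The second derivative of `weightedQuot f q r s`. -/
noncomputable def weightedQuotDeriv2 (f q : ℝ → ℝ) (r s t : ℝ) : ℝ :=
  (deriv (deriv q) t * (f t - weightedQuot f q r s t)
    + 2 * deriv q t * (deriv f t - weightedQuotDeriv f q r s t)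
    + q t * deriv (deriv f) t) / (q t + s)

/-- The derivative of `finv ∘ weightedQuot f q r s`, where `finv` is inverse to `f`. -/
noncomputable def quasiMeanDeriv (f finv q : ℝ → ℝ) (r s t : ℝ) : ℝ :=
  weightedQuotDeriv f q r s t / deriv f (finv (weightedQuot f q r s t))

/-- The second derivative of `finv ∘ weightedQuot f q r s`, where `finv` is inverse to `f`. -/
noncomputable def quasiMeanDeriv2 (f finv q : ℝ → ℝ) (r s t : ℝ) : ℝ :=
  (weightedQuotDeriv2 f q r s t
    - deriv (deriv f) (finv (weightedQuot f q r s t)) * quasiMeanDeriv f finv q r s t ^ 2)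
  / deriv f (finv (weightedQuot f q r s t))

section

variable {f finv q : ℝ → ℝ} {r s t : ℝ}

lemma hasDerivAt_weightedQuot (hf : DifferentiableAt ℝ f t) (hq : DifferentiableAt ℝ q t)
    (hs : q t + s ≠ 0) :
    HasDerivAt (weightedQuot f q r s) (weightedQuotDeriv f q r s t) t := by
  have h := ((hq.hasDerivAt.mul hf.hasDerivAt).add_const r).div (hq.hasDerivAt.add_const s) hs
  refine h.congr_deriv ?_
  simp only [weightedQuotDeriv, weightedQuot, Pi.mul_apply]
  field_simp
  ring

lemma hasDerivAt_weightedQuotDeriv (hf : DifferentiableAt ℝ f t)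
    (hf2 : DifferentiableAt ℝ (deriv f) t) (hq : DifferentiableAt ℝ q t)
    (hq2 : DifferentiableAt ℝ (deriv q) t) (hs : q t + s ≠ 0) :
    HasDerivAt (weightedQuotDeriv f q r s) (weightedQuotDeriv2 f q r s t) t := by
  have h := ((hq2.hasDerivAt.mul (hf.hasDerivAt.sub
    (hasDerivAt_weightedQuot (r := r) hf hq hs))).add (hq.hasDerivAt.mul hf2.hasDerivAt)).div
    (hq.hasDerivAt.add_const s) hs
  refine h.congr_deriv ?_
  simp only [weightedQuotDeriv2, Pi.mul_apply, Pi.add_apply, Pi.sub_apply]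
  rw [weightedQuotDeriv]
  field_simp
  ring

lemma hasDerivAt_weightedQuotDeriv2_of_eq (hf : DifferentiableAt ℝ f t)
    (hf2 : DifferentiableAt ℝ (deriv f) t) (hf3 : DifferentiableAt ℝ (deriv (deriv f)) t)
    (hq : DifferentiableAt ℝ q t) (hq2 : DifferentiableAt ℝ (deriv q) t)
    (hq3 : ContinuousAt (deriv (deriv q)) t) (hs : q t + s ≠ 0)
    (hd : weightedQuot f q r s t = f t) :
    HasDerivAt (weightedQuotDeriv2 f q r s)
      ((3 * deriv (deriv q) t * (deriv f t - weightedQuotDeriv f q r s t)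
        + 3 * deriv q t * (deriv (deriv f) t - weightedQuotDeriv2 f q r s t)
        + q t * deriv (deriv (deriv f)) t) / (q t + s)) t := by
  have h := ((((HasDerivAt.continuousAt_mul_of_eq_zero hq3 (hf.hasDerivAt.sub
    (hasDerivAt_weightedQuot (r := r) hf hq hs)) (by simp [hd])).add
    ((hq2.hasDerivAt.const_mul 2).mul (hf2.hasDerivAt.sub
      (hasDerivAt_weightedQuotDeriv (r := r) hf hf2 hq hq2 hs)))).add
    (hq.hasDerivAt.mul hf3.hasDerivAt))).div (hq.hasDerivAt.add_const s) hs
  refine h.congr_deriv ?_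
  simp only [Pi.mul_apply, Pi.add_apply, Pi.sub_apply]
  rw [weightedQuotDeriv2, hd]
  field_simp
  ring

lemma hasDerivAt_comp_weightedQuot {a : ℝ} (hf : DifferentiableAt ℝ f t)
    (hq : DifferentiableAt ℝ q t) (hs : q t + s ≠ 0) (ha : weightedQuot f q r s t = f a)
    (hfinv : HasDerivAt finv (deriv f a)⁻¹ (f a)) (hfa : finv (f a) = a) :
    HasDerivAt (fun u => finv (weightedQuot f q r s u)) (quasiMeanDeriv f finv q r s t) t := by
  rw [← ha] at hfinv
  refine (hfinv.comp t (hasDerivAt_weightedQuot hf hq hs)).congr_deriv ?_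
  rw [quasiMeanDeriv, ha, hfa]
  ring

lemma hasDerivAt_quasiMeanDeriv {a : ℝ} (hf : DifferentiableAt ℝ f t)
    (hf2 : DifferentiableAt ℝ (deriv f) t) (hq : DifferentiableAt ℝ q t)
    (hq2 : DifferentiableAt ℝ (deriv q) t) (hs : q t + s ≠ 0) (ha : weightedQuot f q r s t = f a)
    (hfinv : HasDerivAt finv (deriv f a)⁻¹ (f a)) (hfa : finv (f a) = a)
    (hfa2 : DifferentiableAt ℝ (deriv f) a) (hf' : deriv f a ≠ 0) :
    HasDerivAt (quasiMeanDeriv f finv q r s) (quasiMeanDeriv2 f finv q r s t) t := by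
  have hA := hasDerivAt_comp_weightedQuot hf hq hs ha hfinv hfa
  have hAt : finv (weightedQuot f q r s t) = a := by rw [ha, hfa]
  have hF : HasDerivAt (fun u => deriv f (finv (weightedQuot f q r s u))) _ t :=
    HasDerivAt.comp t (h₂ := deriv f) (by rw [hAt]; exact hfa2.hasDerivAt) hA
  refine ((hasDerivAt_weightedQuotDeriv hf hf2 hq hq2 hs).div hF (by rwa [hAt])).congr_deriv ?_
  rw [quasiMeanDeriv2, quasiMeanDeriv, hAt]
  field_simp

lemma hasDerivAt_quasiMeanDeriv2_of_eq (hf : DifferentiableAt ℝ f t)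
    (hf2 : DifferentiableAt ℝ (deriv f) t) (hf3 : DifferentiableAt ℝ (deriv (deriv f)) t)
    (hq : DifferentiableAt ℝ q t) (hq2 : DifferentiableAt ℝ (deriv q) t)
    (hq3 : ContinuousAt (deriv (deriv q)) t) {S : ℝ} (hS : q t + s = S) (hS0 : S ≠ 0)
    (hd : weightedQuot f q r s t = f t)
    (hfinv : HasDerivAt finv (deriv f t)⁻¹ (f t)) (hft : finv (f t) = t) (hf' : deriv f t ≠ 0) :
    HasDerivAt (quasiMeanDeriv2 f finv q r s)
      (3 * (S - q t) * (S * deriv (deriv q) t - 2 * (deriv q t) ^ 2) / S ^ 3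
        + 3 * (deriv q t * (S - 2 * q t) * (S - q t) / S ^ 3) * (deriv (deriv f) t / deriv f t)
        - q t * (S - q t) / S ^ 3 * (3 * q t * (deriv (deriv f) t / deriv f t) ^ 2
          - (S + q t) * (deriv (deriv (deriv f)) t / deriv f t))) t := by
  have hs : q t + s ≠ 0 := hS ▸ hS0
  have hA := hasDerivAt_comp_weightedQuot hf hq hs hd hfinv hft
  have hAt : finv (weightedQuot f q r s t) = t := by rw [hd, hft]
  have hF : HasDerivAt (fun u => deriv f (finv (weightedQuot f q r s u))) _ t :=
    HasDerivAt.comp t (h₂ := deriv f) (by rw [hAt]; exact hf2.hasDerivAt) hA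
  have hF2 : HasDerivAt (fun u => deriv (deriv f) (finv (weightedQuot f q r s u))) _ t :=
    HasDerivAt.comp t (h₂ := deriv (deriv f)) (by rw [hAt]; exact hf3.hasDerivAt) hA
  have hP := hasDerivAt_quasiMeanDeriv hf hf2 hq hq2 hs hd hfinv hft hf2 hf'
  have h := ((hasDerivAt_weightedQuotDeriv2_of_eq hf hf2 hf3 hq hq2 hq3 hs hd).sub
    (hF2.mul (hP.pow 2))).div hF (by rwa [hAt])
  refine h.congr_deriv ?_
  simp only [Pi.mul_apply, Pi.sub_apply, Pi.pow_apply, quasiMeanDeriv2, quasiMeanDeriv,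
    weightedQuotDeriv2, weightedQuotDeriv, hAt, Nat.reduceSub, pow_one, Nat.cast_ofNat]
  simp only [hd, hS]
  field_simp
  ring

end

lemma bmean_update {n : ℕ} (f finv : ℝ → ℝ) (p : Fin n → ℝ → ℝ) (i : Fin n) (y : Fin n → ℝ)
    (t : ℝ) :
    bmean f finv p (Function.update y i t) = finv (weightedQuot f (p i)
      (∑ l ∈ Finset.univ.erase i, p l (y l) * f (y l)) (∑ l ∈ Finset.univ.erase i, p l (y l)) t) := by
  have h : ∀ g : Fin n → ℝ → ℝ, ∑ l, g l (Function.update y i t l)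
      = g i t + ∑ l ∈ Finset.univ.erase i, g l (y l) := fun g => by
    rw [← Finset.add_sum_erase _ _ (Finset.mem_univ i), Function.update_self]
    congr 1
    exact Finset.sum_congr rfl fun l hl => by
      rw [Function.update_of_ne (Finset.ne_of_mem_erase hl)]
  rw [bmean, weightedQuot, h fun l u => p l u * f u, h]

lemma sum_erase_update {ι : Type*} [Fintype ι] [DecidableEq ι] (g : ι → ℝ → ℝ) (i : ι)
    (y : ι → ℝ) (t : ℝ) :
    ∑ l ∈ Finset.univ.erase i, g l (Function.update y i t l)
      = ∑ l ∈ Finset.univ.erase i, g l (y l) :=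
  Finset.sum_congr rfl fun l hl => by rw [Function.update_of_ne (Finset.ne_of_mem_erase hl)]

/-- Theorem DB (3c): if `f` is three times differentiable with nonvanishing
first derivative and `pᵢ` is twice continuously differentiable, then
`∂ᵢ³ A_{f,p}` exists on the diagonal and equals the stated expression. -/
theorem stmt_15 (I : Set ℝ) (hIopen : IsOpen I) (hIne : I.Nonempty)
    (hIconn : I.OrdConnected) (n : ℕ) (hn : 2 ≤ n) (f : ℝ → ℝ)
    (hfd : DifferentiableOn ℝ f I) (hfd2 : DifferentiableOn ℝ (deriv f) I)
    (hfd3 : DifferentiableOn ℝ (deriv (deriv f)) I)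
    (hf' : ∀ x ∈ I, deriv f x ≠ 0)
    (hf : StrictMonoOn f I ∨ StrictAntiOn f I) (finv : ℝ → ℝ)
    (hmaps : Set.MapsTo finv (convexHull ℝ (f '' I)) I)
    (hmono : MonotoneOn finv (convexHull ℝ (f '' I)) ∨
      AntitoneOn finv (convexHull ℝ (f '' I)))
    (hleft : ∀ x ∈ I, finv (f x) = x)
    (p : Fin n → ℝ → ℝ) (hp : ∀ l, ∀ x ∈ I, 0 < p l x)
    (i : Fin n) (hpi : ContDiffOn ℝ 2 (p i) I) :
    ∃ P1 P2 : (Fin n → ℝ) → ℝ,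
      (∀ y : Fin n → ℝ, (∀ l, y l ∈ I) →
        HasDerivAt (fun t => bmean f finv p (Function.update y i t))
          (P1 y) (y i)) ∧
      (∀ y : Fin n → ℝ, (∀ l, y l ∈ I) →
        HasDerivAt (fun t => P1 (Function.update y i t)) (P2 y) (y i)) ∧
      (∀ x ∈ I,
        HasDerivAt
          (fun t => P2 (Function.update (Function.const (Fin n) x) i t))
          (3 * ((∑ l, p l x) - p i x) *
              ((∑ l, p l x) * deriv (deriv (p i)) x - 2 * (deriv (p i) x) ^ 2)
              / (∑ l, p l x) ^ 3
            + 3 * (deriv (p i) x * ((∑ l, p l x) - 2 * p i x)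
                * ((∑ l, p l x) - p i x) / (∑ l, p l x) ^ 3)
              * (deriv (deriv f) x / deriv f x)
            - p i x * ((∑ l, p l x) - p i x) / (∑ l, p l x) ^ 3 *
              (3 * p i x * (deriv (deriv f) x / deriv f x) ^ 2
                - ((∑ l, p l x) + p i x)
                  * (deriv (deriv (deriv f)) x / deriv f x))) x) := by
  have hd : ∀ {g : ℝ → ℝ}, DifferentiableOn ℝ g I → ∀ x ∈ I, DifferentiableAt ℝ g x :=
    fun hg x hx => hg.differentiableAt (hIopen.mem_nhds hx)
  have hq : DifferentiableOn ℝ (p i) I := hpi.differentiableOn (by norm_num)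
  have hpi' : ContDiffOn ℝ 1 (deriv (p i)) I := hpi.deriv_of_isOpen hIopen (by norm_num)
  have hq2 : DifferentiableOn ℝ (deriv (p i)) I := hpi'.differentiableOn (by norm_num)
  have hq3 : ContinuousOn (deriv (deriv (p i))) I :=
    hpi'.continuousOn_deriv_of_isOpen hIopen (by norm_num)
  have hfinv : ∀ a ∈ I, HasDerivAt finv (deriv f a)⁻¹ (f a) := fun a ha => by
    have hstrict : HasStrictDerivAt f (deriv f a) a :=
      hasStrictDerivAt_of_hasDerivAt_of_continuousAt
        (by filter_upwards [hIopen.mem_nhds ha] with u hu using (hd hfd u hu).hasDerivAt)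
        (hd hfd2 a ha).continuousAt
    refine (hstrict.to_local_left_inverse (hf' a ha) ?_).hasDerivAt
    filter_upwards [hIopen.mem_nhds ha] with u hu using hleft u hu
  have hconv : Convex ℝ (f '' I) :=
    (hIconn.isPreconnected.image f hfd.continuousOn).ordConnected.convex
  have hsplit : ∀ (g : Fin n → ℝ), g i + ∑ l ∈ Finset.univ.erase i, g l = ∑ l, g l :=
    fun g => Finset.add_sum_erase _ _ (Finset.mem_univ i)
  have hpos : ∀ y : Fin n → ℝ, (∀ l, y l ∈ I) → 0 < ∑ l, p l (y l) := fun y hy =>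
    Finset.sum_pos (fun l _ => hp l _ (hy l)) ⟨i, Finset.mem_univ i⟩
  set R : (Fin n → ℝ) → ℝ := fun y => ∑ l ∈ Finset.univ.erase i, p l (y l) * f (y l) with hR
  set W : (Fin n → ℝ) → ℝ := fun y => ∑ l ∈ Finset.univ.erase i, p l (y l) with hW
  have hRu : ∀ y t, R (Function.update y i t) = R y :=
    sum_erase_update (fun l u => p l u * f u) i
  have hWu : ∀ y t, W (Function.update y i t) = W y := sum_erase_update p i
  have hD : ∀ y : Fin n → ℝ, (∀ l, y l ∈ I) → p i (y i) + W y ≠ 0 := fun y hy => by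
    rw [hW, hsplit fun l => p l (y l)]
    exact (hpos y hy).ne'
  have hmem : ∀ y : Fin n → ℝ, (∀ l, y l ∈ I) →
      ∃ a ∈ I, weightedQuot f (p i) (R y) (W y) (y i) = f a := fun y hy => by
    have h := hconv.centerMass_mem (t := Finset.univ) (w := fun l => p l (y l))
      (z := fun l => f (y l)) (fun l _ => (hp l _ (hy l)).le) (hpos y hy)
      (fun l _ => Set.mem_image_of_mem f (hy l))
    obtain ⟨a, ha, hfa⟩ := h
    refine ⟨a, ha, ?_⟩
    rw [hfa, weightedQuot, hR, hW, hsplit fun l => p l (y l), hsplit fun l => p l (y l) * f (y l),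
      Finset.centerMass, smul_eq_mul, div_eq_inv_mul]
    simp only [smul_eq_mul]
  refine ⟨fun y => quasiMeanDeriv f finv (p i) (R y) (W y) (y i),
    fun y => quasiMeanDeriv2 f finv (p i) (R y) (W y) (y i), fun y hy => ?_, fun y hy => ?_,
    fun x hx => ?_⟩
  · obtain ⟨a, ha, hya⟩ := hmem y hy
    simp only [bmean_update]
    exact hasDerivAt_comp_weightedQuot (hd hfd _ (hy i)) (hd hq _ (hy i)) (hD y hy) hya
      (hfinv a ha) (hleft a ha)
  · obtain ⟨a, ha, hya⟩ := hmem y hy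
    simp only [hRu, hWu, Function.update_self]
    exact hasDerivAt_quasiMeanDeriv (hd hfd _ (hy i)) (hd hfd2 _ (hy i)) (hd hq _ (hy i))
      (hd hq2 _ (hy i)) (hD y hy) hya (hfinv a ha) (hleft a ha) (hd hfd2 a ha) (hf' a ha)
  · simp only [hRu, hWu, Function.update_self]
    have hS : p i x + W (Function.const (Fin n) x) = ∑ l, p l x := hsplit fun l => p l x
    have hS0 : ∑ l, p l x ≠ 0 := (hpos (Function.const _ x) fun _ => hx).ne'
    refine hasDerivAt_quasiMeanDeriv2_of_eq (hd hfd x hx) (hd hfd2 x hx) (hd hfd3 x hx)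
      (hd hq x hx) (hd hq2 x hx) (hq3.continuousAt (hIopen.mem_nhds hx)) hS hS0 ?_
      (hfinv x hx) (hleft x hx) (hf' x hx)
    have hRW : R (Function.const (Fin n) x) = W (Function.const (Fin n) x) * f x :=
      (Finset.sum_mul _ (fun l => p l x) (f x)).symm
    rw [weightedQuot, hRW, ← add_mul, hS, mul_div_cancel_left₀ _ hS0]
end

section
/- Let I be a nonempty open real interval, let n ≥ 2, let f, g: I → ℝ be differentiable on I with nonvanishing first derivatives, let i ∈ {1,…,n}, and let p = (p_1,…,p_n): I → ℝ_+^n and q = (q_1,…,q_n): I → ℝ_+^n be such that p_i and q_i are continuous on I. If ∂_i A_{f,p} = ∂_i A_{g,q} holds at every point of the diagonal diag(I^n), then q_i/q_0 = p_i/p_0 holds on I, where p_0 = p_1 + … + p_n and q_0 = q_1 + … + q_n. -/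
open Filter Topology

/-- A left inverse of a strictly increasing function has the reciprocal derivative. -/
theorem StrictMonoOn.hasDerivAt_leftInvOn {I : Set ℝ} (hI : IsOpen I) {f finv : ℝ → ℝ}
    (hf : StrictMonoOn f I) (hc : ContinuousOn f I) (hleft : Set.LeftInvOn finv f I)
    {x f' : ℝ} (hx : x ∈ I) (hd : HasDerivAt f f' x) (hf' : f' ≠ 0) :
    HasDerivAt finv f'⁻¹ (f x) := by
  have hmem : f '' I ∈ 𝓝 (f x) := by
    obtain ⟨ε, hε, hball⟩ := Metric.isOpen_iff.1 hI x hx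
    have hsub : Set.Icc (x - ε / 2) (x + ε / 2) ⊆ I := by
      intro y hy
      apply hball
      rw [Real.ball_eq_Ioo]
      constructor <;> linarith [hy.1, hy.2]
    have hle : x - ε / 2 ≤ x + ε / 2 := by linarith
    have hl := hf (hsub (Set.left_mem_Icc.2 hle)) hx (by linarith)
    have hr := hf hx (hsub (Set.right_mem_Icc.2 hle)) (by linarith)
    exact mem_of_superset (Icc_mem_nhds hl hr)
      ((intermediate_value_Icc hle (hc.mono hsub)).trans (Set.image_mono hsub))
  have hmono : MonotoneOn finv (f '' I) := by
    rintro _ ⟨s, hs, rfl⟩ _ ⟨t, ht, rfl⟩ hst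
    rw [hleft hs, hleft ht]
    exact (hf.le_iff_le hs ht).1 hst
  have hcont : ContinuousAt finv (f x) := by
    refine continuousAt_of_monotoneOn_of_image_mem_nhds hmono hmem ?_
    rw [hleft.image_image, hleft hx]
    exact hI.mem_nhds hx
  refine HasDerivAt.of_local_left_inverse hcont (by rwa [hleft hx]) hf' ?_
  filter_upwards [hmem]
  rintro _ ⟨s, hs, rfl⟩
  rw [hleft hs]

/-- A left inverse of a strictly decreasing function has the reciprocal derivative. -/
theorem StrictAntiOn.hasDerivAt_leftInvOn {I : Set ℝ} (hI : IsOpen I) {f finv : ℝ → ℝ}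
    (hf : StrictAntiOn f I) (hc : ContinuousOn f I) (hleft : Set.LeftInvOn finv f I)
    {x f' : ℝ} (hx : x ∈ I) (hd : HasDerivAt f f' x) (hf' : f' ≠ 0) :
    HasDerivAt finv f'⁻¹ (f x) := by
  have hneg : HasDerivAt (fun y => finv (-y)) (-f')⁻¹ (-f x) :=
    StrictMonoOn.hasDerivAt_leftInvOn (f := fun t => -f t) hI
      (fun s hs t ht hst => neg_lt_neg (hf hs ht hst)) hc.neg
      (fun t ht => by simpa using hleft ht) hx hd.neg (neg_ne_zero.2 hf')
  simpa [Function.comp_def, inv_neg] using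
    HasDerivAt.comp (f x) hneg (hasDerivAt_neg (f x))

/-- A product of a continuous function and a differentiable function vanishing at the point
is differentiable there. -/
theorem ContinuousAt.hasDerivAt_mul_of_eq_zero {h k : ℝ → ℝ} {x k' : ℝ}
    (hh : ContinuousAt h x) (hk : HasDerivAt k k' x) (hk0 : k x = 0) :
    HasDerivAt (fun t => h t * k t) (h x * k') x := by
  rw [hasDerivAt_iff_tendsto_slope] at hk ⊢
  refine ((hh.tendsto.mono_left nhdsWithin_le_nhds).mul hk).congr fun t => ?_
  simp only [slope_def_field, hk0, mul_zero, sub_zero]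
  ring

/-- The `i`-th partial derivative of a generalized Bajraktarević mean at a diagonal point. -/
theorem hasDerivAt_bmean_diag {I : Set ℝ} (hI : IsOpen I) {n : ℕ} {f finv : ℝ → ℝ}
    (hfd : DifferentiableOn ℝ f I) (hf' : ∀ x ∈ I, deriv f x ≠ 0)
    (hf : StrictMonoOn f I ∨ StrictAntiOn f I) (hleft : Set.LeftInvOn finv f I)
    {p : Fin n → ℝ → ℝ} (hp : ∀ l, ∀ x ∈ I, 0 < p l x) {i : Fin n}
    (hpi : ContinuousOn (p i) I) {x : ℝ} (hx : x ∈ I) :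
    HasDerivAt
      (fun t => bmean f finv p (Function.update (Function.const (Fin n) x) i t))
      (p i x / ∑ l, p l x) x := by
  have hd : HasDerivAt f (deriv f x) x := (hfd.differentiableAt (hI.mem_nhds hx)).hasDerivAt
  have hinv : HasDerivAt finv (deriv f x)⁻¹ (f x) :=
    hf.elim (fun h => h.hasDerivAt_leftInvOn hI hfd.continuousOn hleft hx hd (hf' x hx))
      (fun h => h.hasDerivAt_leftInvOn hI hfd.continuousOn hleft hx hd (hf' x hx))
  set S := ∑ l ∈ Finset.univ.erase i, p l x with hS
  have hS0 : 0 ≤ S := Finset.sum_nonneg fun l _ => (hp l x hx).le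
  have hsum : ∀ t : ℝ,
      ∑ l, p l (Function.update (Function.const (Fin n) x) i t l) *
        f (Function.update (Function.const (Fin n) x) i t l) = p i t * f t + S * f x := by
    intro t
    rw [← Finset.add_sum_erase _ _ (Finset.mem_univ i), hS, Finset.sum_mul]
    congr 1
    · simp
    · refine Finset.sum_congr rfl fun l hl => ?_
      simp [Function.update_of_ne (Finset.ne_of_mem_erase hl)]
  have hweight : ∀ t : ℝ,
      ∑ l, p l (Function.update (Function.const (Fin n) x) i t l) = p i t + S := by
    intro t
    rw [← Finset.add_sum_erase _ _ (Finset.mem_univ i), hS]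
    congr 1
    · simp
    · refine Finset.sum_congr rfl fun l hl => ?_
      simp [Function.update_of_ne (Finset.ne_of_mem_erase hl)]
  have htotal : ∑ l, p l x = p i x + S := (Finset.add_sum_erase _ _ (Finset.mem_univ i)).symm
  have hpc : ContinuousAt (p i) x := hpi.continuousAt (hI.mem_nhds hx)
  have hpos : 0 < p i x + S := by linarith [hp i x hx]
  have hratio : ContinuousAt (fun t => p i t / (p i t + S)) x :=
    hpc.div (hpc.add continuousAt_const) hpos.ne'
  have hinner := (hratio.hasDerivAt_mul_of_eq_zero (hd.sub_const (f x)) (sub_self _)).const_add (f x)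
  have hcomp := HasDerivAt.comp_of_eq x hinv hinner (by simp)
  rw [htotal]
  have hval : (deriv f x)⁻¹ * (p i x / (p i x + S) * deriv f x) = p i x / (p i x + S) := by
    field_simp [hf' x hx]
  rw [hval] at hcomp
  refine hcomp.congr_of_eventuallyEq ?_
  filter_upwards [hI.mem_nhds hx] with t ht
  have ht0 : p i t + S ≠ 0 := (add_pos_of_pos_of_nonneg (hp i t ht) hS0).ne'
  simp only [bmean, hsum, hweight, Function.comp_apply]
  congr 1
  field_simp
  ring

/-- Lemma 1OC: if the `i`-th first-order partial derivatives of `A_{f,p}` and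
`A_{g,q}` coincide on the diagonal, then `qᵢ/q₀ = pᵢ/p₀` on `I`. -/
theorem stmt_16 (I : Set ℝ) (hIopen : IsOpen I) (hIne : I.Nonempty)
    (hIconn : I.OrdConnected) (n : ℕ) (hn : 2 ≤ n) (f g : ℝ → ℝ)
    (hfd : DifferentiableOn ℝ f I) (hgd : DifferentiableOn ℝ g I)
    (hf' : ∀ x ∈ I, deriv f x ≠ 0) (hg' : ∀ x ∈ I, deriv g x ≠ 0)
    (hf : StrictMonoOn f I ∨ StrictAntiOn f I)
    (hg : StrictMonoOn g I ∨ StrictAntiOn g I)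
    (finvf : ℝ → ℝ)
    (hfmaps : Set.MapsTo finvf (convexHull ℝ (f '' I)) I)
    (hfmono : MonotoneOn finvf (convexHull ℝ (f '' I)) ∨
      AntitoneOn finvf (convexHull ℝ (f '' I)))
    (hfleft : ∀ x ∈ I, finvf (f x) = x)
    (finvg : ℝ → ℝ)
    (hgmaps : Set.MapsTo finvg (convexHull ℝ (g '' I)) I)
    (hgmono : MonotoneOn finvg (convexHull ℝ (g '' I)) ∨
      AntitoneOn finvg (convexHull ℝ (g '' I)))
    (hgleft : ∀ x ∈ I, finvg (g x) = x)
    (p q : Fin n → ℝ → ℝ)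
    (hp : ∀ l, ∀ x ∈ I, 0 < p l x) (hq : ∀ l, ∀ x ∈ I, 0 < q l x)
    (i : Fin n) (hpi : ContinuousOn (p i) I) (hqi : ContinuousOn (q i) I)
    (hpd : ∀ x ∈ I,
      deriv (fun t =>
        bmean f finvf p (Function.update (Function.const (Fin n) x) i t)) x =
      deriv (fun t =>
        bmean g finvg q (Function.update (Function.const (Fin n) x) i t)) x) :
    ∀ x ∈ I, q i x / (∑ l, q l x) = p i x / (∑ l, p l x) := by
  
  intro x hx
  rw [← (hasDerivAt_bmean_diag hIopen hgd hg' hg hgleft hq hqi hx).deriv,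
    ← (hasDerivAt_bmean_diag hIopen hfd hf' hf hfleft hp hpi hx).deriv]
  exact (hpd x hx).symm
end

section
/- Let I be a nonempty open real interval, let n ≥ 2, let f, g: I → ℝ be twice differentiable on I with nonvanishing first derivatives, and let p = (p_1,…,p_n): I → ℝ_+^n and q = (q_1,…,q_n): I → ℝ_+^n be continuous on I with q_i/q_0 = p_i/p_0 on I for all i ∈ {1,…,n}. Let j, k ∈ {1,…,n}. If either (i) j ≠ k, the functions p_j, p_k, q_j, q_k are differentiable on I, and ∂_j∂_k A_{f,p} = ∂_j∂_k A_{g,q} holds on diag(I^n), or (ii) j = k, the functions p_j, q_j are continuously differentiable on I, and ∂_j² A_{f,p} = ∂_j² A_{g,q} holds on diag(I^n), then there exists a nonzero constant γ such that q_i² · g' = γ · p_i² · f' holds on I for every i ∈ {1,…,n}. -/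
/-- The partial derivative of `A` with respect to the `k`-th variable. -/
noncomputable def pd {n : ℕ} (A : (Fin n → ℝ) → ℝ) (k : Fin n)
    (y : Fin n → ℝ) : ℝ :=
  deriv (fun t => A (Function.update y k t)) (y k)

/-- The second-order partial derivative `∂ⱼ∂ₖ A` evaluated at the diagonal
point `(x,…,x)`. -/
noncomputable def pd2diag {n : ℕ} (A : (Fin n → ℝ) → ℝ) (j k : Fin n)
    (x : ℝ) : ℝ :=
  deriv (fun t => pd A k (Function.update (Function.const (Fin n) x) j t)) x

open Function

/-- Regularity data under which the Bajraktarević mean of `f` and `p` is differentiable on `Iⁿ`. -/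
structure IsRegularBMean {n : ℕ} (I : Set ℝ) (f finv : ℝ → ℝ) (p : Fin n → ℝ → ℝ) : Prop where
  isOpen : IsOpen I
  ordConnected : I.OrdConnected
  differentiableOn : DifferentiableOn ℝ f I
  differentiableOn_deriv : DifferentiableOn ℝ (deriv f) I
  deriv_ne_zero : ∀ x ∈ I, deriv f x ≠ 0
  left_inv : ∀ x ∈ I, finv (f x) = x
  weight_pos : ∀ l, ∀ x ∈ I, 0 < p l x

lemma sum_apply_update {n : ℕ} (h : Fin n → ℝ → ℝ) (y : Fin n → ℝ) (k : Fin n) (s : ℝ) :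
    ∑ i, h i (update y k s i) = ∑ i, h i (y i) - h k (y k) + h k s := by
  rw [← Finset.add_sum_erase _ _ (Finset.mem_univ k),
    ← Finset.add_sum_erase Finset.univ (fun i => h i (y i)) (Finset.mem_univ k)]
  have : ∑ i ∈ Finset.univ.erase k, h i (update y k s i) =
      ∑ i ∈ Finset.univ.erase k, h i (y i) :=
    Finset.sum_congr rfl fun i hi => by rw [update_of_ne (Finset.ne_of_mem_erase hi)]
  rw [this, update_self]
  ring

lemma update_const_mem {n : ℕ} {I : Set ℝ} {x t : ℝ} (hx : x ∈ I) (ht : t ∈ I) (j : Fin n)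
    (i : Fin n) : update (const (Fin n) x) j t i ∈ I := by
  rcases eq_or_ne i j with rfl | h
  · simpa using ht
  · simpa [update_of_ne h] using hx

namespace IsRegularBMean

variable {n : ℕ} {I : Set ℝ} {f finv : ℝ → ℝ} {p : Fin n → ℝ → ℝ}

lemma sum_pos (H : IsRegularBMean I f finv p) (k : Fin n) {y : Fin n → ℝ} (hy : ∀ i, y i ∈ I) :
    0 < ∑ i, p i (y i) :=
  Finset.sum_pos (fun i _ => H.weight_pos i _ (hy i)) ⟨k, Finset.mem_univ k⟩

lemma hasDerivAt (H : IsRegularBMean I f finv p) {x : ℝ} (hx : x ∈ I) :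
    HasDerivAt f (deriv f x) x :=
  (H.differentiableOn.differentiableAt (H.isOpen.mem_nhds hx)).hasDerivAt

lemma hasDerivAt_deriv (H : IsRegularBMean I f finv p) {x : ℝ} (hx : x ∈ I) :
    HasDerivAt (deriv f) (deriv (deriv f) x) x :=
  (H.differentiableOn_deriv.differentiableAt (H.isOpen.mem_nhds hx)).hasDerivAt

lemma hasDerivAt_inv (H : IsRegularBMean I f finv p) {x : ℝ} (hx : x ∈ I) :
    HasDerivAt finv (deriv f x)⁻¹ (f x) := by
  have hI := H.isOpen.mem_nhds hx
  have hs : HasStrictDerivAt f (deriv f x) x :=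
    hasStrictDerivAt_of_hasDerivAt_of_continuousAt
      (by filter_upwards [hI] with y hy using H.hasDerivAt hy)
      (H.hasDerivAt_deriv hx).continuousAt
  exact (hs.to_local_left_inverse (H.deriv_ne_zero x hx)
    (by filter_upwards [hI] with y hy using H.left_inv y hy)).hasDerivAt

/-- The mean of points of `I` lies in `I`, and `f` maps it to the weighted average. -/
lemma bmean_spec (H : IsRegularBMean I f finv p) (k : Fin n) {y : Fin n → ℝ}
    (hy : ∀ i, y i ∈ I) :
    bmean f finv p y ∈ I ∧
      f (bmean f finv p y) = (∑ i, p i (y i) * f (y i)) / ∑ i, p i (y i) := by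
  have hconv : Convex ℝ (f '' I) :=
    (H.ordConnected.isPreconnected.image f H.differentiableOn.continuousOn).ordConnected.convex
  have hmem : (∑ i, p i (y i) * f (y i)) / ∑ i, p i (y i) ∈ f '' I := by
    have h := hconv.centerMass_mem (t := Finset.univ) (w := fun i => p i (y i))
      (z := fun i => f (y i)) (fun i _ => (H.weight_pos i _ (hy i)).le) (H.sum_pos k hy)
      (fun i _ => ⟨y i, hy i, rfl⟩)
    simpa [Finset.centerMass, div_eq_inv_mul] using h
  obtain ⟨a, ha, hfa⟩ := hmem
  rw [bmean, ← hfa, H.left_inv a ha]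
  exact ⟨ha, rfl⟩

lemma bmean_const (H : IsRegularBMean I f finv p) (k : Fin n) {x : ℝ} (hx : x ∈ I) :
    bmean f finv p (const (Fin n) x) = x := by
  have h0 := (H.sum_pos k (y := const (Fin n) x) fun _ => hx).ne'
  simp only [const_apply] at h0
  simp only [bmean, const_apply, ← Finset.sum_mul]
  rw [mul_div_cancel_left₀ _ h0, H.left_inv x hx]

lemma hasDerivAt_bmean (H : IsRegularBMean I f finv p) {k : Fin n}
    (hpk : DifferentiableOn ℝ (p k) I) {y : Fin n → ℝ} (hy : ∀ i, y i ∈ I) :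
    HasDerivAt (fun t => bmean f finv p (update y k t))
      ((deriv (p k) (y k) * (f (y k) - f (bmean f finv p y)) + p k (y k) * deriv f (y k)) /
        ((∑ i, p i (y i)) * deriv f (bmean f finv p y))) (y k) := by
  have hP := (H.sum_pos k hy).ne'
  obtain ⟨hA, hfA⟩ := H.bmean_spec k hy
  have hA' := H.deriv_ne_zero _ hA
  have dp : HasDerivAt (p k) (deriv (p k) (y k)) (y k) :=
    (hpk.differentiableAt (H.isOpen.mem_nhds (hy k))).hasDerivAt
  have df := H.hasDerivAt (hy k)
  have dN : HasDerivAt (fun t => ∑ i, p i (update y k t i) * f (update y k t i))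
      (deriv (p k) (y k) * f (y k) + p k (y k) * deriv f (y k)) (y k) := by
    simp only [sum_apply_update fun i s => p i s * f s]
    exact (dp.mul df).const_add _
  have dD : HasDerivAt (fun t => ∑ i, p i (update y k t i)) (deriv (p k) (y k)) (y k) := by
    simp only [sum_apply_update p]
    exact dp.const_add _
  have dq := dN.div dD (by simpa using hP)
  have dinv := H.hasDerivAt_inv hA
  rw [hfA] at dinv
  refine (HasDerivAt.comp_of_eq (y k) dinv dq (by simp)).congr_deriv ?_
  simp only [update_eq_self]
  rw [hfA]
  field_simp
  ring

lemma pd_eq (H : IsRegularBMean I f finv p) {k : Fin n}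
    (hpk : DifferentiableOn ℝ (p k) I) {y : Fin n → ℝ} (hy : ∀ i, y i ∈ I) :
    pd (bmean f finv p) k y =
      (deriv (p k) (y k) * (f (y k) - f (bmean f finv p y)) + p k (y k) * deriv f (y k)) /
        ((∑ i, p i (y i)) * deriv f (bmean f finv p y)) :=
  (H.hasDerivAt_bmean hpk hy).deriv

lemma hasDerivAt_bmean_const (H : IsRegularBMean I f finv p) {j : Fin n}
    (hpj : DifferentiableOn ℝ (p j) I) {x : ℝ} (hx : x ∈ I) :
    HasDerivAt (fun t => bmean f finv p (update (const (Fin n) x) j t))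
      (p j x / ∑ i, p i x) x := by
  have h := H.hasDerivAt_bmean hpj (y := const (Fin n) x) fun _ => hx
  have hf := H.deriv_ne_zero x hx
  refine h.congr_deriv ?_
  rw [H.bmean_const j hx]
  simp only [const_apply, sub_self, mul_zero, zero_add]
  rw [mul_div_mul_right _ _ hf]

/-- The second derivative on the diagonal, in terms of the derivative `w` of the numerator of the
first-order partial derivative. -/
lemma pd2diag_eq_of_hasDerivAt (H : IsRegularBMean I f finv p) {j k : Fin n}
    (hpj : DifferentiableOn ℝ (p j) I) (hpk : DifferentiableOn ℝ (p k) I) {x w : ℝ} (hx : x ∈ I)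
    (hw : HasDerivAt (fun t =>
      deriv (p k) (update (const (Fin n) x) j t k) * (f (update (const (Fin n) x) j t k) -
        f (bmean f finv p (update (const (Fin n) x) j t))) +
      p k (update (const (Fin n) x) j t k) * deriv f (update (const (Fin n) x) j t k)) w x) :
    pd2diag (bmean f finv p) j k x =
      (w * ((∑ i, p i x) * deriv f x) - p k x * deriv f x *
        (deriv (p j) x * deriv f x + p j x * deriv (deriv f) x)) /
        ((∑ i, p i x) * deriv f x) ^ 2 := by
  have hI := H.isOpen.mem_nhds hx
  have hP : (∑ i, p i x) ≠ 0 := (H.sum_pos k (y := fun _ => x) fun _ => hx).ne'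
  have hf := H.deriv_ne_zero x hx
  have hu : update (const (Fin n) x) j x = const (Fin n) x := update_eq_self j (const (Fin n) x)
  have hA := H.bmean_const j hx
  have dD : HasDerivAt (fun t => ∑ i, p i (update (const (Fin n) x) j t i)) (deriv (p j) x) x := by
    simp only [sum_apply_update p]
    exact (hpj.differentiableAt hI).hasDerivAt.const_add _
  have dA : HasDerivAt (fun t => deriv f (bmean f finv p (update (const (Fin n) x) j t)))
      (deriv (deriv f) x * (p j x / ∑ i, p i x)) x :=
    HasDerivAt.comp_of_eq x (H.hasDerivAt_deriv hx) (H.hasDerivAt_bmean_const hpj hx)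
      (by rw [hu, hA])
  have hne : (∑ i, p i (update (const (Fin n) x) j x i)) *
      deriv f (bmean f finv p (update (const (Fin n) x) j x)) ≠ 0 := by
    rw [hu, hA]
    exact mul_ne_zero hP hf
  have dq := hw.div (dD.mul dA) hne
  refine (dq.congr_of_eventuallyEq ?_).deriv.trans ?_
  · filter_upwards [hI] with t ht using H.pd_eq hpk (update_const_mem hx ht j)
  simp only [Pi.mul_apply, hu, hA, const_apply, sub_self, mul_zero, zero_add]
  field_simp

lemma pd2diag_of_ne (H : IsRegularBMean I f finv p) {j k : Fin n} (hjk : j ≠ k)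
    (hpj : DifferentiableOn ℝ (p j) I) (hpk : DifferentiableOn ℝ (p k) I) {x : ℝ} (hx : x ∈ I) :
    pd2diag (bmean f finv p) j k x =
      -(p j x / ∑ i, p i x) * (p k x / ∑ i, p i x) *
        (deriv (p j) x / p j x + deriv (p k) x / p k x + deriv (deriv f) x / deriv f x) := by
  have hP : (∑ i, p i x) ≠ 0 := (H.sum_pos k (y := fun _ => x) fun _ => hx).ne'
  have hf := H.deriv_ne_zero x hx
  have hj := (H.weight_pos j x hx).ne'
  have hk := (H.weight_pos k x hx).ne'
  have hu : update (const (Fin n) x) j x = const (Fin n) x := update_eq_self j (const (Fin n) x)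
  have dfA : HasDerivAt (fun t => f (bmean f finv p (update (const (Fin n) x) j t)))
      (deriv f x * (p j x / ∑ i, p i x)) x :=
    HasDerivAt.comp_of_eq x (H.hasDerivAt hx) (H.hasDerivAt_bmean_const hpj hx)
      (by rw [hu, H.bmean_const j hx])
  rw [H.pd2diag_eq_of_hasDerivAt hpj hpk hx
    (w := deriv (p k) x * -(deriv f x * (p j x / ∑ i, p i x)))]
  · field_simp
    ring
  · simp only [update_of_ne hjk.symm, const_apply]
    exact ((dfA.const_sub _).const_mul _).add_const _

lemma pd2diag_self (H : IsRegularBMean I f finv p) {j : Fin n}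
    (hpj : ContDiffOn ℝ 1 (p j) I) {x : ℝ} (hx : x ∈ I) :
    pd2diag (bmean f finv p) j j x =
      (p j x / ∑ i, p i x) * (1 - p j x / ∑ i, p i x) *
        (deriv (p j) x / p j x + deriv (p j) x / p j x + deriv (deriv f) x / deriv f x) := by
  have hI := H.isOpen.mem_nhds hx
  have hP : (∑ i, p i x) ≠ 0 := (H.sum_pos j (y := fun _ => x) fun _ => hx).ne'
  have hf := H.deriv_ne_zero x hx
  have hj := (H.weight_pos j x hx).ne'
  have hd : DifferentiableOn ℝ (p j) I := hpj.differentiableOn one_ne_zero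
  have hc : ContinuousAt (deriv (p j)) x :=
    (hpj.continuousOn_deriv_of_isOpen H.isOpen le_rfl).continuousAt hI
  have hu : update (const (Fin n) x) j x = const (Fin n) x := update_eq_self j (const (Fin n) x)
  have hA := H.bmean_const j hx
  have dfA : HasDerivAt (fun t => f t - f (bmean f finv p (update (const (Fin n) x) j t)))
      (deriv f x - deriv f x * (p j x / ∑ i, p i x)) x :=
    (H.hasDerivAt hx).sub <|
      HasDerivAt.comp_of_eq x (H.hasDerivAt hx) (H.hasDerivAt_bmean_const hd hx) (by rw [hu, hA])
  have dm : HasDerivAt (fun t => deriv (p j) t *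
      (f t - f (bmean f finv p (update (const (Fin n) x) j t))))
      (deriv (p j) x * (deriv f x - deriv f x * (p j x / ∑ i, p i x))) x := by
    rw [hasDerivAt_iff_tendsto_slope] at dfA ⊢
    refine ((hc.tendsto.mono_left nhdsWithin_le_nhds).mul dfA).congr fun t => ?_
    simp only [slope_def_field, hu, hA, sub_self, mul_zero, sub_zero]
    ring
  rw [H.pd2diag_eq_of_hasDerivAt hd hd hx
    (w := deriv (p j) x * (deriv f x - deriv f x * (p j x / ∑ i, p i x)) +
      (deriv (p j) x * deriv f x + p j x * deriv (deriv f) x))]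
  · field_simp
    ring
  · simp only [update_self]
    exact dm.add ((hd.differentiableAt hI).hasDerivAt.mul (H.hasDerivAt_deriv hx))

end IsRegularBMean

/-- Two nonvanishing functions with equal logarithmic derivatives on an interval are
proportional. -/
lemma exists_eq_const_mul_of_logDeriv_eq {I : Set ℝ} (hI : IsOpen I) (hIne : I.Nonempty)
    (hIc : I.OrdConnected) {φ ψ : ℝ → ℝ} (hφ : DifferentiableOn ℝ φ I)
    (hψ : DifferentiableOn ℝ ψ I) (hφ0 : ∀ x ∈ I, φ x ≠ 0) (hψ0 : ∀ x ∈ I, ψ x ≠ 0)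
    (h : ∀ x ∈ I, logDeriv φ x = logDeriv ψ x) :
    ∃ γ : ℝ, γ ≠ 0 ∧ ∀ x ∈ I, ψ x = γ * φ x := by
  obtain ⟨γ, hγ⟩ := hI.exists_is_const_of_deriv_eq_zero hIc.isPreconnected (hψ.div hφ hφ0)
    fun x hx => by
      have dφ := (hφ.differentiableAt (hI.mem_nhds hx)).hasDerivAt
      have dψ := (hψ.differentiableAt (hI.mem_nhds hx)).hasDerivAt
      have h' := h x hx
      rw [logDeriv_apply, logDeriv_apply, div_eq_div_iff (hφ0 x hx) (hψ0 x hx)] at h'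
      rw [(dψ.div dφ (hφ0 x hx)).deriv, ← h', mul_comm, mul_comm (ψ x)]
      simp [mul_comm]
  obtain ⟨x₀, hx₀⟩ := hIne
  refine ⟨γ, ?_, fun x hx => ?_⟩
  · rw [← hγ x₀ hx₀]
    exact div_ne_zero (hψ0 x₀ hx₀) (hφ0 x₀ hx₀)
  · rw [← hγ x hx]
    exact (div_mul_cancel₀ _ (hφ0 x hx)).symm

lemma logDeriv_mul_mul {I : Set ℝ} (hI : IsOpen I) {u v h : ℝ → ℝ} (hu : DifferentiableOn ℝ u I)
    (hv : DifferentiableOn ℝ v I) (hh : DifferentiableOn ℝ h I) (hu0 : ∀ x ∈ I, u x ≠ 0)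
    (hv0 : ∀ x ∈ I, v x ≠ 0) (hh0 : ∀ x ∈ I, h x ≠ 0) {x : ℝ} (hx : x ∈ I) :
    logDeriv (fun t => u t * v t * h t) x =
      deriv u x / u x + deriv v x / v x + deriv h x / h x := by
  have hxI := hI.mem_nhds hx
  have du := hu.differentiableAt hxI
  have dv := hv.differentiableAt hxI
  rw [logDeriv_mul (f := fun t => u t * v t) x (mul_ne_zero (hu0 x hx) (hv0 x hx)) (hh0 x hx) (du.mul dv)
    (hh.differentiableAt hxI), logDeriv_mul x (hu0 x hx) (hv0 x hx) du dv]
  simp only [logDeriv_apply]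

/-- Lemma 2OC: under first-order proportionality `qᵢ/q₀ = pᵢ/p₀` and equality
of the second-order partial derivatives `∂ⱼ∂ₖ` (for `j ≠ k`, with
differentiable weights) or `∂ⱼ²` (for `j = k`, with continuously differentiable
weights) on the diagonal, there is a nonzero constant `γ` with
`qᵢ² g' = γ pᵢ² f'` on `I` for every `i`. -/
theorem stmt_17 (I : Set ℝ) (hIopen : IsOpen I) (hIne : I.Nonempty)
    (hIconn : I.OrdConnected) (n : ℕ) (hn : 2 ≤ n) (f g : ℝ → ℝ)
    (hfd : DifferentiableOn ℝ f I) (hfd2 : DifferentiableOn ℝ (deriv f) I)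
    (hgd : DifferentiableOn ℝ g I) (hgd2 : DifferentiableOn ℝ (deriv g) I)
    (hf' : ∀ x ∈ I, deriv f x ≠ 0) (hg' : ∀ x ∈ I, deriv g x ≠ 0)
    (hf : StrictMonoOn f I ∨ StrictAntiOn f I)
    (hg : StrictMonoOn g I ∨ StrictAntiOn g I)
    (finvf : ℝ → ℝ)
    (hfmaps : Set.MapsTo finvf (convexHull ℝ (f '' I)) I)
    (hfmono : MonotoneOn finvf (convexHull ℝ (f '' I)) ∨
      AntitoneOn finvf (convexHull ℝ (f '' I)))
    (hfleft : ∀ x ∈ I, finvf (f x) = x)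
    (finvg : ℝ → ℝ)
    (hgmaps : Set.MapsTo finvg (convexHull ℝ (g '' I)) I)
    (hgmono : MonotoneOn finvg (convexHull ℝ (g '' I)) ∨
      AntitoneOn finvg (convexHull ℝ (g '' I)))
    (hgleft : ∀ x ∈ I, finvg (g x) = x)
    (p q : Fin n → ℝ → ℝ)
    (hp : ∀ l, ∀ x ∈ I, 0 < p l x) (hq : ∀ l, ∀ x ∈ I, 0 < q l x)
    (hpc : ∀ l, ContinuousOn (p l) I) (hqc : ∀ l, ContinuousOn (q l) I)
    (hratio : ∀ l, ∀ x ∈ I, q l x / (∑ m, q m x) = p l x / (∑ m, p m x))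
    (j k : Fin n)
    (hcase :
      (j ≠ k ∧ DifferentiableOn ℝ (p j) I ∧ DifferentiableOn ℝ (p k) I ∧
        DifferentiableOn ℝ (q j) I ∧ DifferentiableOn ℝ (q k) I ∧
        ∀ x ∈ I, pd2diag (bmean f finvf p) j k x =
          pd2diag (bmean g finvg q) j k x) ∨
      (j = k ∧ ContDiffOn ℝ 1 (p j) I ∧ ContDiffOn ℝ 1 (q j) I ∧
        ∀ x ∈ I, pd2diag (bmean f finvf p) j j x =
          pd2diag (bmean g finvg q) j j x)) :
    ∃ γ : ℝ, γ ≠ 0 ∧ ∀ i : Fin n, ∀ x ∈ I,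
      (q i x) ^ 2 * deriv g x = γ * ((p i x) ^ 2 * deriv f x) := by
  have Hp : IsRegularBMean I f finvf p := ⟨hIopen, hIconn, hfd, hfd2, hf', hfleft, hp⟩
  have Hq : IsRegularBMean I g finvg q := ⟨hIopen, hIconn, hgd, hgd2, hg', hgleft, hq⟩
  have hp0 : ∀ x ∈ I, 0 < ∑ m, p m x := fun x hx => Hp.sum_pos j (y := fun _ => x) fun _ => hx
  have hq0 : ∀ x ∈ I, 0 < ∑ m, q m x := fun x hx => Hq.sum_pos j (y := fun _ => x) fun _ => hx
  obtain ⟨hpj, hpk, hqj, hqk, hlog⟩ : DifferentiableOn ℝ (p j) I ∧ DifferentiableOn ℝ (p k) I ∧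
      DifferentiableOn ℝ (q j) I ∧ DifferentiableOn ℝ (q k) I ∧ ∀ x ∈ I,
        deriv (p j) x / p j x + deriv (p k) x / p k x + deriv (deriv f) x / deriv f x =
        deriv (q j) x / q j x + deriv (q k) x / q k x + deriv (deriv g) x / deriv g x := by
    rcases hcase with ⟨hjk, hpj, hpk, hqj, hqk, h⟩ | ⟨rfl, hpj, hqj, h⟩
    · refine ⟨hpj, hpk, hqj, hqk, fun x hx => ?_⟩
      have h' := h x hx
      rw [Hp.pd2diag_of_ne hjk hpj hpk hx, Hq.pd2diag_of_ne hjk hqj hqk hx, hratio j x hx,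
        hratio k x hx] at h'
      have hj := div_pos (hp j x hx) (hp0 x hx)
      have hk := div_pos (hp k x hx) (hp0 x hx)
      exact mul_left_cancel₀ (mul_ne_zero (neg_ne_zero.2 hj.ne') hk.ne') h'
    · have dp := hpj.differentiableOn one_ne_zero
      have dq := hqj.differentiableOn one_ne_zero
      refine ⟨dp, dp, dq, dq, fun x hx => ?_⟩
      have h' := h x hx
      rw [Hp.pd2diag_self hpj hx, Hq.pd2diag_self hqj hx, hratio j x hx] at h'
      have hj := div_pos (hp j x hx) (hp0 x hx)
      have : Nontrivial (Fin n) := Fin.nontrivial_iff_two_le.2 hn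
      obtain ⟨l, hl⟩ := exists_ne j
      have hlt : p j x < ∑ m, p m x :=
        Finset.single_lt_sum hl (Finset.mem_univ j) (Finset.mem_univ l) (hp l x hx)
          fun m _ _ => (hp m x hx).le
      have h1 : 0 < 1 - p j x / ∑ m, p m x := sub_pos.2 ((div_lt_one (hp0 x hx)).2 hlt)
      exact mul_left_cancel₀ (mul_pos hj h1).ne' h'
  have hpn : ∀ l, ∀ x ∈ I, p l x ≠ 0 := fun l x hx => (hp l x hx).ne'
  have hqn : ∀ l, ∀ x ∈ I, q l x ≠ 0 := fun l x hx => (hq l x hx).ne'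
  obtain ⟨γ, hγ, hprop⟩ := exists_eq_const_mul_of_logDeriv_eq hIopen hIne hIconn
    (φ := fun x => p j x * p k x * deriv f x) (ψ := fun x => q j x * q k x * deriv g x)
    ((hpj.mul hpk).mul hfd2) ((hqj.mul hqk).mul hgd2)
    (fun x hx => mul_ne_zero (mul_ne_zero (hpn j x hx) (hpn k x hx)) (hf' x hx))
    (fun x hx => mul_ne_zero (mul_ne_zero (hqn j x hx) (hqn k x hx)) (hg' x hx))
    fun x hx => by
      rw [logDeriv_mul_mul hIopen hpj hpk hfd2 (hpn j) (hpn k) hf' hx,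
        logDeriv_mul_mul hIopen hqj hqk hgd2 (hqn j) (hqn k) hg' hx, hlog x hx]
  refine ⟨γ, hγ, fun i x hx => ?_⟩
  have hq_eq : ∀ l, q l x = p l x * ((∑ m, q m x) / ∑ m, p m x) := fun l => by
    rw [← div_mul_cancel₀ (q l x) (hq0 x hx).ne', hratio l x hx]
    ring
  have h := hprop x hx
  rw [hq_eq j, hq_eq k] at h
  rw [hq_eq i]
  refine mul_left_cancel₀ (mul_ne_zero (hpn j x hx) (hpn k x hx)) ?_
  linear_combination p i x ^ 2 * h
end
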